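/- arXiv:1511.03991 — 2 statements merged into one kernel-verified Lean document; each statement's English description precedes it below -/
import Mathlib

section
/- Let M, N, M', N' be finitely generated R-modules and suppose there are short exact sequences of R-modules 0 → M' → F → M → 0 and 0 → N' → G → N → 0 with F and G finitely generated free R-modules (so M' is a syzygy of M and N' is a syzygy of N). Then for every ideal J ⊆ I generated by a Q-regular sequence whose images in V are k-linearly independent: Ext^i_{Q/J}(M,N) ≠ 0 for infinitely many i if and only if Ext^i_{Q/J}(M',N') ≠ 0 for infinitely many i. (Equivalently, V_R^d(M,N) = V_R^d(M',N').) -/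
open CategoryTheory IsLocalRing

/-- A local ring is regular if its maximal ideal can be generated by a regular sequence. -/
def IsRegularLocal (Q : Type) [CommRing Q] [IsLocalRing Q] : Prop :=
  ∃ rs : List Q, RingTheory.Sequence.IsRegular Q rs ∧
    Ideal.span {x | x ∈ rs} = maximalIdeal Q

theorem Module.IsTorsionBySet.mono' {Q M : Type} [CommRing Q] [AddCommGroup M] [Module Q M]
    {J I : Ideal Q} (h : Module.IsTorsionBySet Q M (I : Set Q)) (hJI : J ≤ I) :
    Module.IsTorsionBySet Q M (J : Set Q) := fun x a => @h x ⟨a.1, hJI a.2⟩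

/-- The `Q ⧸ J`-module structure on a module annihilated by `I ⊇ J`. -/
def modOver {Q : Type} [CommRing Q] {I : Ideal Q} (J : Ideal Q) (hJI : J ≤ I)
    (M : Type) [AddCommGroup M] [Module Q M]
    (hM : Module.IsTorsionBySet Q M (I : Set Q)) : Module (Q ⧸ J) M :=
  (hM.mono' hJI).module

theorem quot_isTorsionBySet (Q : Type) [CommRing Q] (J : Ideal Q) :
    Module.IsTorsionBySet Q (Q ⧸ J) (J : Set Q) := fun x a => by
  induction x using Quotient.inductionOn with
  | h q =>
    show ((a : Q) • Submodule.Quotient.mk q : Q ⧸ J) = 0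
    rw [← Submodule.Quotient.mk_smul, Submodule.Quotient.mk_eq_zero, smul_eq_mul]
    exact Ideal.mul_mem_right q J a.2

/-- The residue field `k = Q/𝔪` as a module over `Q ⧸ J` for any `J ≤ 𝔪`. -/
def kMod {Q : Type} [CommRing Q] [IsLocalRing Q] (J : Ideal Q) (hJm : J ≤ maximalIdeal Q) :
    Module (Q ⧸ J) (Q ⧸ maximalIdeal Q) :=
  modOver J hJm (Q ⧸ maximalIdeal Q) (quot_isTorsionBySet Q (maximalIdeal Q))

/-- `Ext^i_A(M, N)`, as a module over `A`, for explicitly given module structures. -/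
noncomputable def extMod (A : Type) [CommRing A] (M N : Type) [AddCommGroup M] [AddCommGroup N]
    (mM : Module A M) (mN : Module A N) (i : ℕ) : ModuleCat A :=
  ((Ext A (ModuleCat A) i).obj (Opposite.op (@ModuleCat.of A _ M _ mM))).obj
    (@ModuleCat.of A _ N _ mN)

/-- `Ext^i_A(M, N) ≠ 0` for infinitely many `i`. -/
def extInf (A : Type) [CommRing A] (M N : Type) [AddCommGroup M] [AddCommGroup N]
    (mM : Module A M) (mN : Module A N) : Prop :=
  ∀ n : ℕ, ∃ i, n ≤ i ∧ Nontrivial (extMod A M N mM mN i)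

/-- `Ext^i_A(M, N) = 0` for all `i ≫ 0`. -/
def extVan (A : Type) [CommRing A] (M N : Type) [AddCommGroup M] [AddCommGroup N]
    (mM : Module A M) (mN : Module A N) : Prop :=
  ∃ n₀ : ℕ, ∀ i, n₀ ≤ i → Subsingleton (extMod A M N mM mN i)

/-- The images in `V = I/𝔫I` of the elements `g i` of `I` are `k`-linearly independent. -/
def LinIndepInV (Q : Type) [CommRing Q] [IsLocalRing Q] (I : Ideal Q)
    {d : ℕ} (g : Fin d → Q) : Prop :=
  (∀ i, g i ∈ I) ∧
    ∀ a : Fin d → Q, (∑ i, a i * g i) ∈ maximalIdeal Q * I → ∀ i, a i ∈ maximalIdeal Q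

/-- The depth of a module over a local ring: the supremum of the lengths of
regular sequences on the module consisting of elements of the maximal ideal. -/
noncomputable def localDepth (Q : Type) [CommRing Q] [IsLocalRing Q]
    (M : Type) [AddCommGroup M] [Module Q M] : ℕ :=
  sSup {n | ∃ rs : List Q, rs.length = n ∧ (∀ r ∈ rs, r ∈ maximalIdeal Q) ∧
    RingTheory.Sequence.IsRegular M rs}

open CategoryTheory IsLocalRing

theorem exact_iff_aux {A : Type} [CommRing A] (X Y : ModuleCat.{0} A) (i : ℕ) :
    Subsingleton (((Ext A (ModuleCat A) (i+1)).obj (Opposite.op X)).obj Y) ↔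
      Subsingleton (Abelian.Ext X Y (i+1)) := by
  obtain ⟨P⟩ := (inferInstance : HasProjectiveResolution X).out
  have h1 := (P.isoExt (R := A) (i+1) Y).toLinearEquiv.toEquiv.subsingleton_congr
  rw [h1, ← ModuleCat.isZero_iff_subsingleton, ← HomologicalComplex.exactAt_iff_isZero_homology,
    HomologicalComplex.exactAt_iff' _ i (i+1) (i+2) (by simp) (by simp),
    ShortComplex.moduleCat_exact_iff]
  constructor
  · intro h
    refine subsingleton_of_forall_eq 0 fun α => ?_
    obtain ⟨f, hf, rfl⟩ := P.extMk_surjective α (i+2) rfl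
    rw [P.extMk_eq_zero_iff f (i+2) rfl hf i rfl]
    exact h f hf
  · intro h (f : P.complex.X (i+1) ⟶ Y) (hf : P.complex.d (i+2) (i+1) ≫ f = 0)
    exact (P.extMk_eq_zero_iff f (i+2) rfl hf i rfl).1 (Subsingleton.elim _ _)

theorem shift_left {A : Type} [CommRing A] {S : ShortComplex (ModuleCat.{0} A)} (hS : S.ShortExact)
    (N : ModuleCat.{0} A) (p : ℕ) (hp : HasProjectiveDimensionLT S.X₂ p) (i : ℕ) (hi : p ≤ i) :
    Subsingleton (Abelian.Ext S.X₃ N (i+1)) ↔ Subsingleton (Abelian.Ext S.X₁ N i) := by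
  have z : ∀ j, p ≤ j → ∀ x : Abelian.Ext S.X₂ N j, x = 0 := fun j hj x =>
    x.eq_zero_of_hasProjectiveDimensionLT p hj
  constructor
  · intro h
    refine subsingleton_of_forall_eq 0 fun α => ?_
    obtain ⟨x, rfl⟩ := Abelian.Ext.contravariant_sequence_exact₁ hS N α (add_comm 1 i)
      (Subsingleton.elim _ _)
    rw [z _ hi x]; simp
  · intro h
    refine subsingleton_of_forall_eq 0 fun α => ?_
    obtain ⟨x, rfl⟩ := Abelian.Ext.contravariant_sequence_exact₃ hS N α (z _ (by omega) _)
      (add_comm 1 i)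
    rw [Subsingleton.elim x 0]; simp

theorem shift_right {A : Type} [CommRing A] {S : ShortComplex (ModuleCat.{0} A)} (hS : S.ShortExact)
    (N : ModuleCat.{0} A) (p : ℕ) (hp : HasInjectiveDimensionLT S.X₂ p) (i : ℕ) (hi : p ≤ i) :
    Subsingleton (Abelian.Ext N S.X₁ (i+1)) ↔ Subsingleton (Abelian.Ext N S.X₃ i) := by
  have z : ∀ j, p ≤ j → ∀ x : Abelian.Ext N S.X₂ j, x = 0 := fun j hj x =>
    x.eq_zero_of_hasInjectiveDimensionLT p hj
  constructor
  · intro h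
    refine subsingleton_of_forall_eq 0 fun α => ?_
    obtain ⟨x, rfl⟩ := Abelian.Ext.covariant_sequence_exact₃ N hS α rfl
      (Subsingleton.elim _ _)
    rw [z _ hi x]; simp
  · intro h
    refine subsingleton_of_forall_eq 0 fun α => ?_
    obtain ⟨x, rfl⟩ := Abelian.Ext.covariant_sequence_exact₁ N hS α (z _ (by omega) _) rfl
    rw [Subsingleton.elim x 0]; simp

theorem sesOf {A : Type} [CommRing A] {X Y Z : Type} [AddCommGroup X] [AddCommGroup Y]
    [AddCommGroup Z] [Module A X] [Module A Y] [Module A Z] (f : X →ₗ[A] Y) (g : Y →ₗ[A] Z)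
    (hf : Function.Injective f) (hfg : Function.Exact f g) (hg : Function.Surjective g) :
    (ShortComplex.mk (ModuleCat.ofHom f) (ModuleCat.ofHom g)
      (by ext x; exact hfg.apply_apply_eq_zero x)).ShortExact :=
  ModuleCat.shortComplex_shortExact _ hfg hf hg

/-- Vanishing on cyclic modules in one degree bounds the injective dimension. -/
theorem idLT_of_cyclic {A : Type} [CommRing A] (n : ℕ) (Y : ModuleCat.{0} A)
    (h : ∀ a : Ideal A, Subsingleton (Abelian.Ext (ModuleCat.of A (A ⧸ a)) Y (n+1))) :
    HasInjectiveDimensionLT Y (n+1) := by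
  induction n generalizing Y with
  | zero =>
    rw [zero_add, ← injective_iff_hasInjectiveDimensionLT_one,
      ← Module.injective_iff_injective_object, ← Module.Baer.iff_injective]
    intro a f
    have hS := sesOf a.subtype a.mkQ a.injective_subtype (LinearMap.exact_subtype_mkQ a)
      a.mkQ_surjective
    have := h a
    obtain ⟨x, hx⟩ := Abelian.Ext.contravariant_sequence_exact₁ hS Y
      (Abelian.Ext.mk₀ (ModuleCat.ofHom f)) (n₁ := 1) rfl (Subsingleton.elim _ _)
    obtain ⟨x, rfl⟩ := (Abelian.Ext.mk₀_bijective _ _).2 x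
    rw [Abelian.Ext.mk₀_comp_mk₀] at hx
    have hx := (Abelian.Ext.mk₀_bijective _ _).1 hx
    refine ⟨x.hom, fun y hy => ?_⟩
    have := congrArg (fun q => q.hom ⟨y, hy⟩) hx
    exact this
  | succ n ih =>
    obtain ⟨⟨I, _, f, _⟩⟩ := EnoughInjectives.presentation Y
    have hS := sesOf f.hom f.hom.range.mkQ ((ModuleCat.mono_iff_injective f).mp ‹_›)
      f.hom.exact_map_mkQ_range (Submodule.mkQ_surjective _)
    rw [← hS.hasInjectiveDimensionLT_X₃_iff n (by assumption)]
    refine ih _ fun a => ?_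
    exact (shift_right hS (ModuleCat.of A (A ⧸ a)) 1
      (inferInstanceAs (HasInjectiveDimensionLT I 1)) (n+1) (by omega)).1 (h a)

theorem ext_mid {A : Type} [CommRing A] {S : ShortComplex (ModuleCat.{0} A)} (hS : S.ShortExact)
    (N : ModuleCat.{0} A) (i : ℕ) (h1 : Subsingleton (Abelian.Ext S.X₁ N i))
    (h3 : Subsingleton (Abelian.Ext S.X₃ N i)) : Subsingleton (Abelian.Ext S.X₂ N i) := by
  refine subsingleton_of_forall_eq 0 fun α => ?_
  obtain ⟨x, rfl⟩ := Abelian.Ext.contravariant_sequence_exact₂ hS N α (Subsingleton.elim _ _)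
  rw [Subsingleton.elim x 0]; simp

theorem ext_iso {A : Type} [CommRing A] {X X' : ModuleCat.{0} A} (e : X ≅ X')
    (N : ModuleCat.{0} A) (i : ℕ) (h : Subsingleton (Abelian.Ext X N i)) :
    Subsingleton (Abelian.Ext X' N i) := by
  refine subsingleton_of_forall_eq 0 fun α => ?_
  have : α = (Abelian.Ext.mk₀ e.inv).comp ((Abelian.Ext.mk₀ e.hom).comp α (zero_add i)) (zero_add i) := by
    simp
  rw [this, Subsingleton.elim ((Abelian.Ext.mk₀ e.hom).comp α (zero_add i)) 0]; simp

theorem ext_cyclic {A : Type} [CommRing A] [IsLocalRing A] [IsNoetherianRing A]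
    (Y : ModuleCat.{0} A) [Module.Finite A Y] (n : ℕ)
    (hk : ∀ i, n ≤ i → Subsingleton (Abelian.Ext (ModuleCat.of A (A ⧸ maximalIdeal A)) Y i))
    (a : Ideal A) :
    ∀ i, n ≤ i → Subsingleton (Abelian.Ext (ModuleCat.of A (A ⧸ a)) Y i) := by
  induction a using WellFoundedGT.induction with
  | ind a ih =>
  intro i hi
  by_cases htop : a = ⊤
  · subst htop
    refine subsingleton_of_forall_eq 0 fun α => ?_
    have : Subsingleton (A ⧸ (⊤ : Ideal A)) := Ideal.Quotient.subsingleton_iff.2 rfl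
    have := (ModuleCat.isZero_of_subsingleton
      (ModuleCat.of A (A ⧸ (⊤ : Ideal A)))).hasProjectiveDimensionLT_zero
    exact α.eq_zero_of_hasProjectiveDimensionLT 0 (Nat.zero_le _)
  by_cases hm : maximalIdeal A ≤ a
  · have : a = maximalIdeal A := le_antisymm (le_maximalIdeal htop) hm
    subst this
    exact hk i hi
  obtain ⟨x, hxm, hxa⟩ := SetLike.not_le_iff_exists.1 hm
  let e3 : ((A ⧸ a) ⧸ (LinearMap.lsmul A (A ⧸ a) x).range) ≃ₗ[A] (A ⧸ (a ⊔ Ideal.span {x})) := by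
    refine (Submodule.quotEquivOfEq _ _ ?_).trans
      (Submodule.quotientQuotientEquivQuotientSup a (Ideal.span {x}))
    ext z
    constructor
    · rintro ⟨w, rfl⟩
      obtain ⟨w, rfl⟩ := a.mkQ_surjective w
      exact ⟨x * w, Ideal.mul_mem_right _ _ (Ideal.mem_span_singleton_self x), rfl⟩
    · rintro ⟨w, hw, rfl⟩
      obtain ⟨w, rfl⟩ := Ideal.mem_span_singleton'.1 hw
      exact ⟨a.mkQ w, by rw [mul_comm]; rfl⟩
  have h3 : ∀ i, n ≤ i → Subsingleton (Abelian.Ext (ModuleCat.of A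
      ((A ⧸ a) ⧸ (LinearMap.lsmul A (A ⧸ a) x).range)) Y i) := by
    intro i hi
    refine ext_iso e3.symm.toModuleIso Y i (ih _ ?_ i hi)
    refine lt_of_le_of_ne le_sup_left fun h => hxa ?_
    rw [h]
    exact Ideal.mem_sup_right (Ideal.mem_span_singleton_self x)
  by_cases hreg : ∀ y, x * y ∈ a → y ∈ a
  · have hinj : Function.Injective (LinearMap.lsmul A (A ⧸ a) x) := by
      rw [injective_iff_map_eq_zero]
      intro w hw
      obtain ⟨w, rfl⟩ := a.mkQ_surjective w
      have : a.mkQ (x * w) = 0 := hw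
      rw [Submodule.mkQ_apply, Submodule.Quotient.mk_eq_zero] at this ⊢
      exact hreg w this
    have hS := sesOf (LinearMap.lsmul A (A ⧸ a) x) (LinearMap.lsmul A (A ⧸ a) x).range.mkQ hinj
      (LinearMap.exact_map_mkQ_range _) (Submodule.mkQ_surjective _)
    by_contra hns
    rw [not_subsingleton_iff_nontrivial] at hns
    have hx : x ∈ (Module.annihilator A (Abelian.Ext (ModuleCat.of A (A ⧸ a)) Y i)).jacobson :=
        (IsLocalRing.maximalIdeal_le_jacobson _) hxm
    refine Submodule.top_ne_pointwise_smul_of_mem_jacobson_annihilator hx ?_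
    rw [eq_comm, eq_top_iff]
    rintro y -
    have := h3 (i+1) (by omega)
    obtain ⟨z, hz⟩ := Abelian.Ext.contravariant_sequence_exact₁ hS Y y (add_comm 1 i)
      (Subsingleton.elim _ _)
    have h2 : ModuleCat.ofHom (LinearMap.lsmul A (A ⧸ a) x) = x • 𝟙 (ModuleCat.of A (A ⧸ a)) := rfl
    rw [← hz]
    change (Abelian.Ext.mk₀ (ModuleCat.ofHom (LinearMap.lsmul A (A ⧸ a) x))).comp z _ ∈ _
    rw [h2, Abelian.Ext.mk₀_smul, Abelian.Ext.smul_comp, Abelian.Ext.mk₀_id_comp]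
    exact Submodule.smul_mem_pointwise_smul _ _ ⊤ trivial
  · push Not at hreg
    obtain ⟨y, hy, hya⟩ := hreg
    let l : A →ₗ[A] (A ⧸ a) := LinearMap.toSpanSingleton A _ (a.mkQ x)
    have hker : ∀ y, y ∈ l.ker ↔ x * y ∈ a := by
      intro y
      rw [LinearMap.mem_ker, LinearMap.toSpanSingleton_apply, ← map_smul, Submodule.mkQ_apply,
        Submodule.Quotient.mk_eq_zero, smul_eq_mul, mul_comm]
    have hran : l.range = (LinearMap.lsmul A (A ⧸ a) x).range := by
      ext z
      constructor
      · rintro ⟨w, rfl⟩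
        exact ⟨a.mkQ w, by simp only [l, LinearMap.toSpanSingleton_apply, LinearMap.lsmul_apply, ← map_smul, smul_eq_mul, mul_comm]⟩
      · rintro ⟨w, rfl⟩
        obtain ⟨w, rfl⟩ := a.mkQ_surjective w
        exact ⟨w, by simp only [l, LinearMap.toSpanSingleton_apply, LinearMap.lsmul_apply, ← map_smul, smul_eq_mul, mul_comm]⟩
    let e1 : (A ⧸ l.ker) ≃ₗ[A] (LinearMap.lsmul A (A ⧸ a) x).range :=
      l.quotKerEquivRange.trans (LinearEquiv.ofEq _ _ hran)
    have hS := sesOf (LinearMap.lsmul A (A ⧸ a) x).range.subtype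
      (LinearMap.lsmul A (A ⧸ a) x).range.mkQ (Submodule.injective_subtype _)
      (LinearMap.exact_subtype_mkQ _) (Submodule.mkQ_surjective _)
    refine ext_mid hS Y i (ext_iso e1.toModuleIso Y i (ih _ ?_ i hi)) (h3 i hi)
    refine lt_of_le_of_ne (fun z hz => (hker z).2 (Ideal.mul_mem_left _ _ hz)) fun h => hya ?_
    rw [h]
    exact (hker y).2 hy

theorem idLT_of_regular {Q : Type} [CommRing Q] [IsLocalRing Q] [IsNoetherianRing Q]
    (hQ : ∃ rs : List Q, RingTheory.Sequence.IsRegular Q rs ∧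
    Ideal.span {x | x ∈ rs} = maximalIdeal Q) :
    ∃ n, HasInjectiveDimensionLT (ModuleCat.of Q Q) n := by
  obtain ⟨rs, hrs, hm⟩ := hQ
  have h := ModuleCat.projectiveDimension_quotient_eq_length rs hrs
  have hm' : Ideal.ofList rs = maximalIdeal Q := hm
  rw [hm'] at h
  have h2 : projectiveDimension (ModuleCat.of Q (Q ⧸ maximalIdeal Q)) ≤ (rs.length : ℕ) := by
    rw [← h]
    exact le_of_eq (projectiveDimension_eq_of_iso (Shrink.linearEquiv Q _).symm.toModuleIso)
  rw [projectiveDimension_le_iff] at h2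
  refine ⟨_, idLT_of_cyclic rs.length _ fun a => ext_cyclic _ (rs.length+1) ?_ a _ le_rfl⟩
  intro i hi
  exact HasProjectiveDimensionLT.subsingleton (hX := h2) _ _ i hi _

section Rees

variable {B : Type} [CommRing B] (x : B)

theorem torsion_injective (E : Type) [AddCommGroup E] [Module B E] (hE : Module.Injective B E) :
    Module.Injective (B ⧸ Ideal.span {x}) (Submodule.torsionBy B E x) := by
  rw [← Module.Baer.iff_injective]
  intro a f
  let mk : B →ₗ[B] B ⧸ Ideal.span {x} := (Ideal.span {x}).mkQ
  let b : Ideal B := a.comap (Ideal.Quotient.mk (Ideal.span {x}))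
  let f' : b →ₗ[B] E :=
    { toFun := fun y => (f ⟨Ideal.Quotient.mk _ y.1, y.2⟩ : E)
      map_add' := fun y z => by
        rw [← Submodule.coe_add, ← map_add]; rfl
      map_smul' := fun r y => by
        have := f.map_smul (Ideal.Quotient.mk _ r) ⟨Ideal.Quotient.mk _ y.1, y.2⟩
        exact congrArg Subtype.val this }
  obtain ⟨h, hh⟩ := (Module.Baer.iff_injective.2 hE) b f'
  have hxz : x • h 1 = 0 := by
    have hxb : x ∈ b := by
      change Ideal.Quotient.mk _ x ∈ a
      rw [Ideal.Quotient.eq_zero_iff_mem.2 (Ideal.mem_span_singleton_self x)]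
      exact a.zero_mem
    rw [← map_smul, smul_eq_mul, mul_one, hh x hxb]
    have : (⟨Ideal.Quotient.mk (Ideal.span {x}) x, hxb⟩ : a) = 0 :=
      Subtype.ext (Ideal.Quotient.eq_zero_iff_mem.2 (Ideal.mem_span_singleton_self x))
    change ((f ⟨Ideal.Quotient.mk (Ideal.span {x}) x, hxb⟩ : _) : E) = 0
    rw [this, map_zero]; rfl
  refine ⟨LinearMap.toSpanSingleton _ _ ⟨h 1, (Submodule.mem_torsionBy_iff _ _).2 hxz⟩, ?_⟩
  intro y hy
  obtain ⟨y, rfl⟩ := Ideal.Quotient.mk_surjective y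
  apply Subtype.ext
  have := hh y hy
  refine Eq.trans ?_ this
  conv_rhs => rw [← mul_one y, ← smul_eq_mul, map_smul]
  rfl

/-- The map induced on `x`-torsion. -/
def torsionMap {Y Z : Type} [AddCommGroup Y] [AddCommGroup Z] [Module B Y] [Module B Z]
    (g : Y →ₗ[B] Z) :
    Submodule.torsionBy B Y x →ₗ[B ⧸ Ideal.span {x}] Submodule.torsionBy B Z x where
  toFun y := ⟨g y.1, (Submodule.mem_torsionBy_iff _ _).2 (by
    rw [← map_smul, (Submodule.mem_torsionBy_iff _ _).1 y.2, map_zero])⟩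
  map_add' y z := Subtype.ext (by simp)
  map_smul' r y := by
    obtain ⟨r, rfl⟩ := Ideal.Quotient.mk_surjective r
    apply Subtype.ext
    exact map_smul g r y.1

theorem mem_tor {Y : Type} [AddCommGroup Y] [Module B Y] (y : Submodule.torsionBy B Y x) :
    x • y.1 = 0 := (Submodule.mem_torsionBy_iff _ _).1 y.2

theorem injective_divisible (hx : IsSMulRegular B x) (E : Type) [AddCommGroup E] [Module B E]
    (hE : Module.Injective B E) (e : E) : ∃ w : E, x • w = e := by
  obtain ⟨h, hh⟩ := hE.out (LinearMap.lsmul B B x) hx (LinearMap.toSpanSingleton B E e)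
  refine ⟨h 1, ?_⟩
  have := hh 1
  rw [LinearMap.lsmul_apply, map_smul] at this
  simpa using this

theorem torsion_idLT (n : ℕ) (hx : IsSMulRegular B x) (Z : ModuleCat.{0} B)
    (hdiv : ∀ z : Z, ∃ w : Z, x • w = z)
    (hZ : HasInjectiveDimensionLT Z (n+1)) :
    HasInjectiveDimensionLT (ModuleCat.of (B ⧸ Ideal.span {x}) (Submodule.torsionBy B Z x)) (n+1) := by
  induction n generalizing Z with
  | zero =>
    rw [zero_add, ← injective_iff_hasInjectiveDimensionLT_one,
      ← Module.injective_iff_injective_object] at hZ ⊢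
    exact torsion_injective x Z hZ
  | succ n ih =>
    obtain ⟨⟨E, _, f, _⟩⟩ := EnoughInjectives.presentation Z
    have hf := (ModuleCat.mono_iff_injective f).mp ‹_›
    have hS := sesOf f.hom f.hom.range.mkQ hf
      f.hom.exact_map_mkQ_range (Submodule.mkQ_surjective _)
    have hEB : Module.Injective B E := (Module.injective_iff_injective_object B E).2 ‹_›
    have h3 := (hS.hasInjectiveDimensionLT_X₃_iff n (by assumption)).2 hZ
    have hT := sesOf (torsionMap x f.hom) (torsionMap x f.hom.range.mkQ) ?_ ?_ ?_
    · rw [← hT.hasInjectiveDimensionLT_X₃_iff n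
        ((Module.injective_iff_injective_object _ _).1 (torsion_injective x E hEB))]
      refine ih _ ?_ h3
      intro z
      obtain ⟨e, rfl⟩ := Submodule.mkQ_surjective _ z
      obtain ⟨w, rfl⟩ := injective_divisible x hx E hEB e
      exact ⟨f.hom.range.mkQ w, (map_smul _ _ _).symm⟩
    · intro y z hyz
      exact Subtype.ext (hf (congrArg Subtype.val hyz))
    · intro e
      constructor
      · intro he
        have : f.hom.range.mkQ e.1 = 0 := congrArg Subtype.val he
        rw [Submodule.mkQ_apply, Submodule.Quotient.mk_eq_zero] at this
        obtain ⟨z, hz⟩ := this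
        refine ⟨⟨z, (Submodule.mem_torsionBy_iff _ _).2 (hf ?_)⟩, Subtype.ext hz⟩
        change f.hom (x • z) = f.hom 0
        rw [map_smul, hz, map_zero, mem_tor]
      · rintro ⟨z, rfl⟩
        apply Subtype.ext
        change f.hom.range.mkQ (f.hom z.1) = 0
        rw [Submodule.mkQ_apply, Submodule.Quotient.mk_eq_zero]
        exact ⟨_, rfl⟩
    · rintro ⟨z, hz⟩
      obtain ⟨e, rfl⟩ := Submodule.mkQ_surjective _ z
      rw [Submodule.mem_torsionBy_iff, ← map_smul, Submodule.mkQ_apply,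
        Submodule.Quotient.mk_eq_zero] at hz
      obtain ⟨y, hy⟩ := hz
      obtain ⟨w, rfl⟩ := hdiv y
      refine ⟨⟨e - f.hom w, ?_⟩, ?_⟩
      · rw [Submodule.mem_torsionBy_iff, smul_sub, ← hy, map_smul, sub_self]
      · apply Subtype.ext
        change f.hom.range.mkQ (e - f.hom w) = f.hom.range.mkQ e
        rw [map_sub, sub_eq_self, Submodule.mkQ_apply, Submodule.Quotient.mk_eq_zero]
        exact ⟨_, rfl⟩

theorem quot_idLT (n : ℕ) (hx : IsSMulRegular B x) (Y : ModuleCat.{0} B)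
    (hxY : IsSMulRegular Y x) (hY : HasInjectiveDimensionLT Y (n+2)) :
    HasInjectiveDimensionLT (ModuleCat.of (B ⧸ Ideal.span {x}) (QuotSMulTop x Y)) (n+1) := by
  obtain ⟨⟨E, _, f, _⟩⟩ := EnoughInjectives.presentation Y
  have hf := (ModuleCat.mono_iff_injective f).mp ‹_›
  have hS := sesOf f.hom f.hom.range.mkQ hf
    f.hom.exact_map_mkQ_range (Submodule.mkQ_surjective _)
  have hEB : Module.Injective B E := (Module.injective_iff_injective_object B E).2 ‹_›
  have h3 := (hS.hasInjectiveDimensionLT_X₃_iff n (by assumption)).2 hY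
  have h4 := torsion_idLT x n hx _ (fun z => by
      obtain ⟨e, rfl⟩ := Submodule.mkQ_surjective _ z
      obtain ⟨w, rfl⟩ := injective_divisible x hx E hEB e
      exact ⟨f.hom.range.mkQ w, (map_smul _ _ _).symm⟩) h3
  have hex : ∀ z : Submodule.torsionBy B (E ⧸ f.hom.range) x, ∃ y : Y, ∃ e : E,
      f.hom.range.mkQ e = z.1 ∧ x • e = f.hom y := by
    rintro ⟨z, hz⟩
    obtain ⟨e, rfl⟩ := Submodule.mkQ_surjective _ z
    rw [Submodule.mem_torsionBy_iff, ← map_smul, Submodule.mkQ_apply,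
        Submodule.Quotient.mk_eq_zero] at hz
    obtain ⟨y, hy⟩ := hz
    exact ⟨y, e, rfl, hy.symm⟩
  choose δ ε hε hδ using hex
  let q : Y →ₗ[B] QuotSMulTop x Y := Submodule.mkQ _
  have hq : ∀ y : Y, q y = 0 ↔ ∃ w, x • w = y := by
    intro y
    rw [Submodule.mkQ_apply, Submodule.Quotient.mk_eq_zero,
      Submodule.mem_smul_pointwise_iff_exists]
    simp
  have key : ∀ (z : Submodule.torsionBy B (E ⧸ f.hom.range) x) (y : Y) (e : E),
      f.hom.range.mkQ e = z.1 → x • e = f.hom y → q (δ z) = q y := by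
    intro z y e h1 h2
    rw [← sub_eq_zero, ← map_sub, hq]
    have h5 : f.hom.range.mkQ (ε z - e) = 0 := by rw [map_sub, hε, h1, sub_self]
    rw [Submodule.mkQ_apply, Submodule.Quotient.mk_eq_zero] at h5
    obtain ⟨w, hw⟩ := h5
    refine ⟨w, hf ?_⟩
    change f.hom (x • w) = f.hom (δ z - y)
    rw [map_smul, hw, smul_sub, hδ, h2, map_sub]
  let Δ : Submodule.torsionBy B (E ⧸ f.hom.range) x →ₗ[B ⧸ Ideal.span {x}] QuotSMulTop x Y :=
    { toFun := fun z => q (δ z)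
      map_add' := fun z w => by
        rw [← map_add]
        refine key _ _ (ε z + ε w) ?_ ?_
        · rw [map_add, hε, hε]; rfl
        · rw [smul_add, hδ, hδ, map_add]
      map_smul' := fun r z => by
        obtain ⟨r, rfl⟩ := Ideal.Quotient.mk_surjective r
        refine Eq.trans (key _ (r • δ z) (r • ε z) ?_ ?_) (map_smul q r (δ z))
        · rw [map_smul, hε]; rfl
        · rw [smul_comm, hδ, map_smul] }
  have hT := sesOf (torsionMap x f.hom.range.mkQ) Δ ?_ ?_ ?_
  · refine hT.hasInjectiveDimensionLT_X₃ (n+1) h4 ?_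
    have : Injective (ModuleCat.of (B ⧸ Ideal.span {x}) (Submodule.torsionBy B E x)) :=
      ((Module.injective_iff_injective_object _ _).1 (torsion_injective x E hEB))
    exact hasInjectiveDimensionLT_of_ge (ModuleCat.of (B ⧸ Ideal.span {x})
      (Submodule.torsionBy B E x)) 1 (n+1+1) (by omega)
  · rw [injective_iff_map_eq_zero]
    intro e he
    have : f.hom.range.mkQ e.1 = 0 := congrArg Subtype.val he
    rw [Submodule.mkQ_apply, Submodule.Quotient.mk_eq_zero] at this
    obtain ⟨y, hy⟩ := this
    have h6 : x • y = x • (0 : Y) := by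
      apply hf
      change f.hom (x • y) = f.hom (x • 0)
      rw [map_smul, hy, mem_tor, smul_zero, map_zero]
    have : y = 0 := hxY h6
    apply Subtype.ext
    rw [← hy, this, map_zero]; rfl
  · intro z
    constructor
    · intro hz
      obtain ⟨w, hw⟩ := (hq _).1 hz
      refine ⟨⟨ε z - f.hom w, ?_⟩, Subtype.ext ?_⟩
      · rw [Submodule.mem_torsionBy_iff, smul_sub, hδ, ← hw, map_smul, sub_self]
      · change f.hom.range.mkQ (ε z - f.hom w) = z.1
        rw [map_sub, hε, sub_eq_self, Submodule.mkQ_apply, Submodule.Quotient.mk_eq_zero]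
        exact ⟨_, rfl⟩
    · rintro ⟨e, rfl⟩
      refine (key _ 0 e.1 rfl ?_).trans (map_zero q)
      rw [mem_tor, map_zero]
  · intro y
    obtain ⟨y, rfl⟩ := Submodule.mkQ_surjective _ y
    obtain ⟨e, he⟩ := injective_divisible x hx E hEB (f.hom y)
    refine ⟨⟨f.hom.range.mkQ e, ?_⟩, key _ y e rfl he⟩
    rw [Submodule.mem_torsionBy_iff, ← map_smul, he, Submodule.mkQ_apply,
        Submodule.Quotient.mk_eq_zero]
    exact ⟨_, rfl⟩

end Rees

theorem idLT_quot_list (n : ℕ) : ∀ {B A : Type} [CommRing B] [CommRing A] (φ : B →+* A)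
    (rs : List B), rs.length = n → Function.Surjective φ → RingHom.ker φ = Ideal.ofList rs →
    RingTheory.Sequence.IsWeaklyRegular B rs →
    (∃ m, HasInjectiveDimensionLT (ModuleCat.of B B) m) →
    ∃ m, HasInjectiveDimensionLT (ModuleCat.of A A) m := by
  induction n with
  | zero =>
    intro B A _ _ φ rs hl hφ hk _ ⟨m, hm⟩
    rw [List.length_eq_zero_iff.1 hl, Ideal.ofList_nil] at hk
    let e : B ≃+* A := RingEquiv.ofBijective φ ⟨(RingHom.injective_iff_ker_eq_bot φ).2 hk, hφ⟩
    let _ := RingHomInvPair.of_ringEquiv e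
    let _ := RingHomInvPair.of_ringEquiv e.symm
    have : HasInjectiveDimensionLE (ModuleCat.of B B) m :=
      hasInjectiveDimensionLT_of_ge _ m (m+1) (by omega)
    refine ⟨m+1, (ModuleCat.hasInjectiveDimensionLE_iff_of_semiLinearEquiv e (N := ModuleCat.of A A)
      e.toSemilinearEquiv m).1 this⟩
  | succ n ih =>
    intro B A _ _ φ rs hl hφ hk hreg ⟨m, hm⟩
    obtain _ | ⟨x, rs⟩ := rs
    · simp at hl
    rw [RingTheory.Sequence.isWeaklyRegular_cons_iff'] at hreg
    obtain ⟨hx, hreg⟩ := hreg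
    have hx0 : Ideal.span {x} ≤ RingHom.ker φ := by rw [hk, Ideal.ofList_cons]; exact le_sup_left
    have e : QuotSMulTop x B ≃ₗ[B ⧸ Ideal.span {x}] (B ⧸ Ideal.span {x}) := by
      refine LinearEquiv.extendScalarsOfSurjective (R := B) Ideal.Quotient.mk_surjective
        (Submodule.quotEquivOfEq _ _ ?_)
      ext z
      rw [Submodule.mem_smul_pointwise_iff_exists, Ideal.mem_span_singleton']
      simp [mul_comm]
    have hx0' : ∀ a ∈ Ideal.span {x}, φ a = 0 := fun a ha => RingHom.mem_ker.1 (hx0 ha)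
    refine ih (Ideal.Quotient.lift (Ideal.span {x}) φ hx0')
      (rs.map (Ideal.Quotient.mk _)) (by simpa using hl) 
      (Ideal.Quotient.lift_surjective_of_surjective _ _ hφ) ?_ ?_ ?_
    · rw [← Ideal.map_ofList]
      ext z
      obtain ⟨z, rfl⟩ := Ideal.Quotient.mk_surjective z
      rw [RingHom.mem_ker, Ideal.Quotient.lift_mk, ← RingHom.mem_ker, hk,
        Ideal.mem_map_iff_of_surjective _ Ideal.Quotient.mk_surjective, Ideal.ofList_cons]
      constructor
      · intro h
        obtain ⟨a, ha, b, hb, rfl⟩ := Submodule.mem_sup.1 h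
        exact ⟨b, hb, by rw [map_add, Ideal.Quotient.eq_zero_iff_mem.2 ha, zero_add]⟩
      · rintro ⟨b, hb, h⟩
        rw [Ideal.Quotient.eq] at h
        have : b - (b - z) ∈ Ideal.span {x} ⊔ Ideal.ofList rs :=
          sub_mem (Submodule.mem_sup_right hb) (Submodule.mem_sup_left h)
        simpa using this
    · exact (e.isWeaklyRegular_congr _).1 hreg
    · have h2 : HasInjectiveDimensionLT (ModuleCat.of B B) (m+2) :=
        hasInjectiveDimensionLT_of_ge _ m (m+2) (by omega)
      have := quot_idLT x m hx (ModuleCat.of B B) hx h2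
      exact ⟨m+1, hasInjectiveDimensionLT_of_iso e.toModuleIso (m+1)⟩

section Exchange

open RingTheory.Sequence

theorem ofList_perm {Q : Type} [CommRing Q] {l l' : List Q} (h : l.Perm l') :
    Ideal.ofList l = Ideal.ofList l' := by
  have : {r | r ∈ l} = {r | r ∈ l'} := Set.ext fun r => h.mem_iff
  rw [Ideal.ofList, this]

theorem pick_unit {Q : Type} [CommRing Q] [IsLocalRing Q] (hs : List Q) :
    ∀ y ∈ Ideal.ofList hs, y ∈ maximalIdeal Q * Ideal.ofList hs ∨
      ∃ h l u, hs.Perm (h :: l) ∧ IsUnit u ∧ y - u * h ∈ Ideal.ofList l := by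
  induction hs with
  | nil =>
    intro y hy
    left
    rw [Ideal.ofList_nil, Ideal.mem_bot] at hy
    rw [hy]; exact zero_mem _
  | cons h hs ih =>
    intro y hy
    rw [Ideal.ofList_cons] at hy
    obtain ⟨a, ha, z, hz, rfl⟩ := Submodule.mem_sup.1 hy
    obtain ⟨u, rfl⟩ := Ideal.mem_span_singleton'.1 ha
    by_cases hu : IsUnit u
    · exact Or.inr ⟨h, hs, u, List.Perm.refl _, hu, by simpa using hz⟩
    · obtain h1 | ⟨h', l, v, hp, hv, hl⟩ := ih z hz
      · left
        rw [Ideal.ofList_cons, Ideal.mul_sup]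
        exact Submodule.add_mem_sup
          (Ideal.mul_mem_mul ((mem_maximalIdeal _).2 hu) (Ideal.mem_span_singleton_self h)) h1
      · right
        refine ⟨h', h :: l, v, (List.Perm.cons h hp).trans (List.Perm.swap _ _ _), hv, ?_⟩
        rw [Ideal.ofList_cons, add_sub_assoc]
        exact Submodule.add_mem_sup (Ideal.mul_mem_left _ _ (Ideal.mem_span_singleton_self h)) hl

theorem exchange {Q : Type} [CommRing Q] [IsLocalRing Q] [IsNoetherianRing Q]
    (I : Ideal Q) (hI : I ≤ maximalIdeal Q)
    (fs : List Q) (hfs : IsWeaklyRegular Q fs) (hIf : Ideal.ofList fs = I) (d : ℕ) :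
    ∀ g : Fin d → Q, LinIndepInV Q I g →
      ∃ hs : List Q, IsWeaklyRegular Q (List.ofFn g ++ hs) ∧
        Ideal.ofList (List.ofFn g ++ hs) = I := by
  induction d with
  | zero => exact fun g _ => ⟨fs, by simpa using hfs, by simpa using hIf⟩
  | succ d ih =>
    intro g hg
    obtain ⟨hs, hreg, hgen⟩ := ih (fun i => g i.succ) ⟨fun i => hg.1 _, fun a ha i => by
      have := hg.2 (Fin.cons 0 a) (by simpa [Fin.sum_univ_succ] using ha) i.succ
      simpa using this⟩
    have hmem : ∀ r ∈ List.ofFn (fun i : Fin d => g i.succ) ++ hs, r ∈ maximalIdeal Q := fun r hr =>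
      hI (hgen ▸ Ideal.subset_span hr)
    have h0 := hg.1 0
    rw [← hgen, Ideal.ofList_append] at h0
    obtain ⟨t, ht, y, hy, hty⟩ := Submodule.mem_sup.1 h0
    have ht' : ∃ a : Fin d → Q, ∑ i, a i * g i.succ = t := by
      have : {r | r ∈ List.ofFn (fun i : Fin d => g i.succ)} = Set.range (fun i : Fin d => g i.succ) := by
        ext r; simp [List.mem_ofFn]
      rw [Ideal.ofList, this] at ht
      exact Ideal.mem_span_range_iff_exists_fun.1 ht
    obtain ⟨a, ha⟩ := ht'
    obtain h1 | ⟨h, l, u, hp, hu, hl⟩ := pick_unit hs y hy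
    · exfalso
      have hle : Ideal.ofList hs ≤ I := by
        rw [← hgen, Ideal.ofList_append]; exact le_sup_right
      have := hg.2 (Fin.cons 1 (fun i => - a i)) (by
        rw [Fin.sum_univ_succ]
        simp only [Fin.cons_zero, Fin.cons_succ, one_mul, neg_mul, Finset.sum_neg_distrib, ha]
        rw [← hty, add_neg_cancel_comm]
        exact Ideal.mul_mono_right hle h1) 0
      rw [Fin.cons_zero] at this
      exact (Ideal.ne_top_iff_one _).1 (maximalIdeal.isMaximal Q).ne_top this
    · set gs := List.ofFn (fun i : Fin d => g i.succ) with hgs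
      have hp2 : (gs ++ hs).Perm ((gs ++ l) ++ [h]) := by
        rw [List.append_assoc]
        exact List.Perm.append_left _ (hp.trans (List.perm_append_singleton h l).symm)
      have hreg2 := isWeaklyRegular_of_perm_of_subset_maximalIdeal hreg hp2 hmem
      have hgen2 := (ofList_perm hp2).symm.trans hgen
      rw [isWeaklyRegular_append_iff, isWeaklyRegular_singleton_iff] at hreg2
      obtain ⟨hr1, hr2⟩ := hreg2
      have hdiff : g 0 - u * h ∈ Ideal.ofList (gs ++ l) := by
        rw [Ideal.ofList_append, ← hty, add_sub_assoc]
        exact Submodule.add_mem_sup ht hl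
      have hr3 : IsSMulRegular (Q ⧸ (Ideal.ofList (gs ++ l) • ⊤ : Submodule Q Q)) (g 0) := by
        have hr4 : IsSMulRegular (Q ⧸ (Ideal.ofList (gs ++ l) • ⊤ : Submodule Q Q)) (u * h) :=
          (hu.isSMulRegular _).mul hr2
        have heq : ∀ z : Q ⧸ (Ideal.ofList (gs ++ l) • ⊤ : Submodule Q Q),
            g 0 • z = (u * h) • z := by
          intro z
          obtain ⟨z, rfl⟩ := Submodule.mkQ_surjective _ z
          rw [← sub_eq_zero, ← sub_smul, ← map_smul, Submodule.mkQ_apply,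
            Submodule.Quotient.mk_eq_zero]
          exact Submodule.smul_mem_smul hdiff trivial
        intro z w hzw
        apply hr4
        change (u * h) • z = (u * h) • w
        rw [← heq, ← heq]; exact hzw
      have hreg3 : IsWeaklyRegular Q ((gs ++ l) ++ [g 0]) := by
        rw [isWeaklyRegular_append_iff, isWeaklyRegular_singleton_iff]
        exact ⟨hr1, hr3⟩
      have hp3 : ((gs ++ l) ++ [g 0]).Perm (List.ofFn g ++ l) := by
        rw [List.ofFn_succ, List.cons_append]
        exact List.perm_append_singleton _ _
      have hgen3 : Ideal.ofList ((gs ++ l) ++ [g 0]) = I := by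
        rw [← hgen2, Ideal.ofList_append, Ideal.ofList_append (gs ++ l) [h],
          Ideal.ofList_singleton, Ideal.ofList_singleton]
        apply le_antisymm
        · refine sup_le le_sup_left ?_
          rw [Ideal.span_singleton_le_iff_mem]
          have := Submodule.add_mem_sup hdiff
            (Ideal.mul_mem_left _ u (Ideal.mem_span_singleton_self h))
          simpa using this
        · refine sup_le le_sup_left ?_
          rw [Ideal.span_singleton_le_iff_mem, ← Ideal.unit_mul_mem_iff_mem _ hu]
          have := Submodule.add_mem_sup (neg_mem hdiff) (Ideal.mem_span_singleton_self (g 0))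
          simpa using this
      refine ⟨l, isWeaklyRegular_of_perm_of_subset_maximalIdeal hreg3 hp3 ?_,
        (ofList_perm hp3).symm.trans hgen3⟩
      intro r hr
      exact hI (hgen3 ▸ Ideal.subset_span hr)

end Exchange

section FiniteDim

open RingTheory.Sequence Pointwise

theorem P_quot {A : Type} [CommRing A] (P : ModuleCat.{0} A → Prop)
    (hiso : ∀ {X Y : ModuleCat.{0} A}, (X ≅ Y) → P X → P Y)
    (h3 : ∀ {S : ShortComplex (ModuleCat.{0} A)}, S.ShortExact → P S.X₁ → P S.X₂ → P S.X₃)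
    (rs : List A) : ∀ (X : Type) [AddCommGroup X] [Module A X],
    IsWeaklyRegular X rs → P (ModuleCat.of A X) →
    P (ModuleCat.of A (X ⧸ (Ideal.ofList rs • ⊤ : Submodule A X))) := by
  induction rs with
  | nil =>
    intro X _ _ _ hX
    refine hiso (LinearEquiv.toModuleIso ?_) hX
    exact (Submodule.quotEquivOfEqBot _ (by rw [Ideal.ofList_nil, Submodule.bot_smul])).symm
  | cons r rs ih =>
    intro X _ _ hreg hX
    rw [isWeaklyRegular_cons_iff] at hreg
    refine hiso (LinearEquiv.toModuleIso
      (Submodule.quotOfListConsSMulTopEquivQuotSMulTopInner X r rs).symm) (ih _ hreg.2 ?_)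
    exact h3 (IsSMulRegular.smulShortComplex_shortExact (M := ModuleCat.of A X) hreg.1) hX hX

theorem P_pi {A : Type} [CommRing A] (P : ModuleCat.{0} A → Prop)
    (hiso : ∀ {X Y : ModuleCat.{0} A}, (X ≅ Y) → P X → P Y)
    (h2 : ∀ {S : ShortComplex (ModuleCat.{0} A)}, S.ShortExact → P S.X₁ → P S.X₃ → P S.X₂)
    (h0 : P (ModuleCat.of A PUnit.{1}))
    (X : Type) [AddCommGroup X] [Module A X] (hX : P (ModuleCat.of A X)) (n : ℕ) :
    P (ModuleCat.of A (Fin n → X)) := by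
  induction n with
  | zero => exact hiso (LinearEquiv.toModuleIso (default : PUnit.{1} ≃ₗ[A] (Fin 0 → X))) h0
  | succ n ih =>
    have e : (X × (Fin n → X)) ≃ₗ[A] (Fin (n+1) → X) := Fin.consLinearEquiv A (fun _ => X)
    refine hiso (LinearEquiv.toModuleIso e) ?_
    exact h2 (sesOf (LinearMap.inl A X (Fin n → X)) (LinearMap.snd A X (Fin n → X))
      LinearMap.inl_injective Function.Exact.inl_snd LinearMap.snd_surjective) hX ih

end FiniteDim

theorem finite_pd {A : Type} [CommRing A] (rs : List A)
    (hrs : RingTheory.Sequence.IsWeaklyRegular A rs) (n : ℕ) :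
    ∃ m, HasProjectiveDimensionLT (ModuleCat.of A (Fin n → A ⧸ (Ideal.ofList rs • ⊤ : Submodule A A))) m := by
  have up : ∀ {X : ModuleCat.{0} A} {m : ℕ} (m' : ℕ), m ≤ m' → HasProjectiveDimensionLT X m →
    HasProjectiveDimensionLT X m' := fun {X m} m' h _ => hasProjectiveDimensionLT_of_ge X m m' h
  have hiso : ∀ {X Y : ModuleCat.{0} A}, (X ≅ Y) → (∃ m, HasProjectiveDimensionLT X m) →
      (∃ m, HasProjectiveDimensionLT Y m) := fun {X Y} e ⟨m, hm⟩ =>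
    ⟨m, hasProjectiveDimensionLT_of_iso e m⟩
  refine P_pi (fun X => ∃ m, HasProjectiveDimensionLT X m) hiso ?_ ?_ _
    (P_quot (fun X => ∃ m, HasProjectiveDimensionLT X m) hiso ?_ rs A hrs ?_) n
  · rintro S hS ⟨a, ha⟩ ⟨b, hb⟩
    exact ⟨max a b, hS.hasProjectiveDimensionLT_X₂ _ (up _ (by omega) ha) (up _ (by omega) hb)⟩
  · exact ⟨1, (projective_iff_hasProjectiveDimensionLT_one).1
      (ModuleCat.projective_of_free (ι := Fin 0) (M := ModuleCat.of A PUnit.{1}) (Module.Basis.empty _))⟩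
  · rintro S hS ⟨a, ha⟩ ⟨b, hb⟩
    exact ⟨max a b + 1,
      hS.hasProjectiveDimensionLT_X₃ _ (up _ (by omega) ha) (up _ (by omega) hb)⟩
  · exact ⟨1, (projective_iff_hasProjectiveDimensionLT_one).1
      (ModuleCat.projective_of_free (M := ModuleCat.of A A) (Module.Basis.singleton Unit A))⟩

theorem finite_id {A : Type} [CommRing A] (rs : List A)
    (hrs : RingTheory.Sequence.IsWeaklyRegular A rs) (n : ℕ)
    (hA : ∃ m, HasInjectiveDimensionLT (ModuleCat.of A A) m) :
    ∃ m, HasInjectiveDimensionLT (ModuleCat.of A (Fin n → A ⧸ (Ideal.ofList rs • ⊤ : Submodule A A))) m := by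
  have up : ∀ {X : ModuleCat.{0} A} {m : ℕ} (m' : ℕ), m ≤ m' → HasInjectiveDimensionLT X m →
    HasInjectiveDimensionLT X m' := fun {X m} m' h _ => hasInjectiveDimensionLT_of_ge X m m' h
  have hiso : ∀ {X Y : ModuleCat.{0} A}, (X ≅ Y) → (∃ m, HasInjectiveDimensionLT X m) →
      (∃ m, HasInjectiveDimensionLT Y m) := fun {X Y} e ⟨m, hm⟩ =>
    ⟨m, hasInjectiveDimensionLT_of_iso e m⟩
  refine P_pi (fun X => ∃ m, HasInjectiveDimensionLT X m) hiso ?_ ?_ _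
    (P_quot (fun X => ∃ m, HasInjectiveDimensionLT X m) hiso ?_ rs A hrs hA) n
  · rintro S hS ⟨a, ha⟩ ⟨b, hb⟩
    exact ⟨max a b, hS.hasInjectiveDimensionLT_X₂ _ (up _ (by omega) ha) (up _ (by omega) hb)⟩
  · exact ⟨0, (hasInjectiveDimensionLT_zero_iff_isZero _).2 (ModuleCat.isZero_of_subsingleton _)⟩
  · rintro S hS ⟨a, ha⟩ ⟨b, hb⟩
    exact ⟨max a b,
      hS.hasInjectiveDimensionLT_X₃ _ (up _ (by omega) hb) (up _ (by omega) ha)⟩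

theorem extInf_iff {A : Type} [CommRing A] (M N : Type) [AddCommGroup M] [AddCommGroup N]
    [mM : Module A M] [mN : Module A N] :
    extInf A M N mM mN ↔ ∀ n : ℕ, ∃ i, n ≤ i ∧
      ¬ Subsingleton (Abelian.Ext (ModuleCat.of A M) (ModuleCat.of A N) i) := by
  have key : ∀ i, Nontrivial (extMod A M N mM mN (i+1)) ↔
      ¬ Subsingleton (Abelian.Ext (ModuleCat.of A M) (ModuleCat.of A N) (i+1)) := by
    intro i
    rw [← exact_iff_aux, not_subsingleton_iff_nontrivial]
    rfl
  constructor
  · intro h n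
    obtain ⟨_ | i, hi, h'⟩ := h (n+1)
    · omega
    · exact ⟨i+1, by omega, (key i).1 h'⟩
  · intro h n
    obtain ⟨_ | i, hi, h'⟩ := h (n+1)
    · omega
    · exact ⟨i+1, by omega, (key i).2 h'⟩

theorem main_aux {A : Type} [CommRing A] (M N M' N' F G : Type)
    [AddCommGroup M] [AddCommGroup N] [AddCommGroup M'] [AddCommGroup N'] [AddCommGroup F]
    [AddCommGroup G] [mM : Module A M] [mN : Module A N] [mM' : Module A M'] [mN' : Module A N']
    [Module A F] [Module A G]
    (ιM : M' →ₗ[A] F) (πM : F →ₗ[A] M) (ιN : N' →ₗ[A] G) (πN : G →ₗ[A] N)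
    (hιM : Function.Injective ιM) (hπM : Function.Surjective πM)
    (hMexact : Function.Exact ιM πM)
    (hιN : Function.Injective ιN) (hπN : Function.Surjective πN)
    (hNexact : Function.Exact ιN πN)
    (hF : ∃ p, HasProjectiveDimensionLT (ModuleCat.of A F) p)
    (hG : ∃ p, HasInjectiveDimensionLT (ModuleCat.of A G) p) :
    extInf A M N mM mN ↔ extInf A M' N' mM' mN' := by
  obtain ⟨p, hp⟩ := hF
  obtain ⟨q, hq⟩ := hG
  have hS := sesOf ιM πM hιM hMexact hπM
  have hT := sesOf ιN πN hιN hNexact hπN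
  have key : ∀ i, p ≤ i → q ≤ i →
      (Subsingleton (Abelian.Ext (ModuleCat.of A M) (ModuleCat.of A N) (i+1)) ↔
        Subsingleton (Abelian.Ext (ModuleCat.of A M') (ModuleCat.of A N') (i+1))) := fun i h1 h2 =>
    (shift_left hS (ModuleCat.of A N) p hp i h1).trans
      (shift_right hT (ModuleCat.of A M') q hq i h2).symm
  rw [extInf_iff, extInf_iff]
  constructor
  · intro h n
    obtain ⟨_ | i, hi, h'⟩ := h (n + p + q + 1)
    · omega
    · exact ⟨i+1, by omega, (not_congr (key i (by omega) (by omega))).1 h'⟩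
  · intro h n
    obtain ⟨_ | i, hi, h'⟩ := h (n + p + q + 1)
    · omega
    · exact ⟨i+1, by omega, (not_congr (key i (by omega) (by omega))).2 h'⟩

/-- Semilinear restriction: a `Q`-linear map is linear over the quotient ring. -/
def linOver {Q : Type} [CommRing Q] (J : Ideal Q) {X Y : Type} [AddCommGroup X] [AddCommGroup Y]
    [Module Q X] [Module Q Y] [Module (Q ⧸ J) X] [Module (Q ⧸ J) Y]
    [IsScalarTower Q (Q ⧸ J) X] [IsScalarTower Q (Q ⧸ J) Y] (f : X →ₗ[Q] Y) :
    X →ₗ[Q ⧸ J] Y :=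
  LinearMap.extendScalarsOfSurjective Ideal.Quotient.mk_surjective f

theorem quot_equiv {Q : Type} [CommRing Q] (I J : Ideal Q) (hs : List Q)
    (hI : I = J ⊔ Ideal.ofList hs) (X : Type) [AddCommGroup X] [Module Q X] [Module (Q ⧸ J) X]
    [IsScalarTower Q (Q ⧸ J) X] (n : ℕ) (e : X ≃ₗ[Q] (Fin n → Q ⧸ I)) :
    Nonempty (X ≃ₗ[Q ⧸ J] (Fin n → (Q ⧸ J) ⧸
      (Ideal.ofList (hs.map (Ideal.Quotient.mk J)) • ⊤ : Submodule (Q ⧸ J) (Q ⧸ J)))) := by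
  set L : Submodule (Q ⧸ J) (Q ⧸ J) := Ideal.ofList (hs.map (Ideal.Quotient.mk J)) • ⊤ with hL
  let φ : Q →ₗ[Q] ((Q ⧸ J) ⧸ L) := (L.mkQ.restrictScalars Q).comp J.mkQ
  have hφ : Function.Surjective φ :=
    (Submodule.mkQ_surjective L).comp (Submodule.mkQ_surjective J)
  have hker : LinearMap.ker φ = I := by
    ext z
    have h1 : φ z = 0 ↔ Ideal.Quotient.mk J z ∈ L := Submodule.Quotient.mk_eq_zero L
    rw [LinearMap.mem_ker, h1, hL, smul_eq_mul, Ideal.mul_top, ← Ideal.map_ofList, hI,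
      ← Ideal.mem_comap, Ideal.comap_map_of_surjective _ Ideal.Quotient.mk_surjective,
      ← RingHom.ker_eq_comap_bot, Ideal.mk_ker, sup_comm]
  let e1 : (Q ⧸ I) ≃ₗ[Q] ((Q ⧸ J) ⧸ L) :=
    (Submodule.quotEquivOfEq _ _ hker.symm).trans (φ.quotKerEquivOfSurjective hφ)
  exact ⟨LinearEquiv.extendScalarsOfSurjective (R := Q) Ideal.Quotient.mk_surjective
    (e.trans (LinearEquiv.piCongrRight fun _ => e1))⟩

/-- Syzygy invariance: `V_R^d(M,N) = V_R^d(M',N')` for syzygies `M'`, `N'`. -/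
theorem statement7
    (Q : Type) [CommRing Q] [IsLocalRing Q] [IsNoetherianRing Q]
    (hQreg : IsRegularLocal Q)
    (c : ℕ) (hc : 1 ≤ c) (f : Fin c → Q)
    (hfreg : RingTheory.Sequence.IsRegular Q (List.ofFn f))
    (I : Ideal Q) (hIf : I = Ideal.span (Set.range f))
    (hIsq : I ≤ maximalIdeal Q ^ 2)
    (M N : Type) [AddCommGroup M] [AddCommGroup N] [Module Q M] [Module Q N]
    [Module.Finite Q M] [Module.Finite Q N]
    (hM : Module.IsTorsionBySet Q M (I : Set Q))
    (hN : Module.IsTorsionBySet Q N (I : Set Q))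
    (M' N' F G : Type) [AddCommGroup M'] [AddCommGroup N'] [AddCommGroup F] [AddCommGroup G]
    [Module Q M'] [Module Q N'] [Module Q F] [Module Q G]
    [Module.Finite Q M'] [Module.Finite Q N'] [Module.Finite Q F] [Module.Finite Q G]
    (hM' : Module.IsTorsionBySet Q M' (I : Set Q))
    (hN' : Module.IsTorsionBySet Q N' (I : Set Q))
    (hF : Module.IsTorsionBySet Q F (I : Set Q))
    (hG : Module.IsTorsionBySet Q G (I : Set Q))
    (hFfree : ∃ n : ℕ, Nonempty (F ≃ₗ[Q] (Fin n → Q ⧸ I)))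
    (hGfree : ∃ n : ℕ, Nonempty (G ≃ₗ[Q] (Fin n → Q ⧸ I)))
    (ιM : M' →ₗ[Q] F) (πM : F →ₗ[Q] M) (ιN : N' →ₗ[Q] G) (πN : G →ₗ[Q] N)
    (hιM : Function.Injective ιM) (hπM : Function.Surjective πM)
    (hMexact : Function.Exact ιM πM)
    (hιN : Function.Injective ιN) (hπN : Function.Surjective πN)
    (hNexact : Function.Exact ιN πN)
    (d : ℕ) (g : Fin d → Q)
    (hgreg : RingTheory.Sequence.IsRegular Q (List.ofFn g))
    (hglin : LinIndepInV Q I g)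
    (J : Ideal Q) (hJg : J = Ideal.span (Set.range g)) (hJI : J ≤ I)
 :
    extInf (Q ⧸ J) M N (modOver J hJI M hM) (modOver J hJI N hN) ↔
      extInf (Q ⧸ J) M' N' (modOver J hJI M' hM') (modOver J hJI N' hN') := by

  have hIm : I ≤ maximalIdeal Q := hIsq.trans (Ideal.pow_le_self (by norm_num))
  have hof : ∀ {d : ℕ} (g : Fin d → Q), Ideal.span (Set.range g) = Ideal.ofList (List.ofFn g) := by
    intro d g
    have : {r | r ∈ List.ofFn g} = Set.range g := by ext r; simp [List.mem_ofFn]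
    rw [Ideal.ofList, this]
  have hJl : J = Ideal.ofList (List.ofFn g) := hJg.trans (hof g)
  obtain ⟨hs, hreg, hgen⟩ := exchange I hIm (List.ofFn f) hfreg.toIsWeaklyRegular
    (hIf.trans (hof f)).symm d g hglin
  have hid : ∃ m, HasInjectiveDimensionLT (ModuleCat.of (Q ⧸ J) (Q ⧸ J)) m :=
    idLT_quot_list _ (Ideal.Quotient.mk J) (List.ofFn g) rfl Ideal.Quotient.mk_surjective
      (by rw [Ideal.mk_ker, hJl]) hgreg.toIsWeaklyRegular (idLT_of_regular hQreg)
  have hI2 : I = J ⊔ Ideal.ofList hs := by rw [← hgen, Ideal.ofList_append, hJl]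
  have hwr : RingTheory.Sequence.IsWeaklyRegular (Q ⧸ J) (hs.map (Ideal.Quotient.mk J)) := by
    have h1 := ((RingTheory.Sequence.isWeaklyRegular_append_iff Q _ _).1 hreg).2
    have e : (Q ⧸ (Ideal.ofList (List.ofFn g) • ⊤ : Submodule Q Q)) ≃ₗ[Q] Q ⧸ J :=
      Submodule.quotEquivOfEq _ _ (by rw [smul_eq_mul, Ideal.mul_top, hJl])
    rw [e.isWeaklyRegular_congr] at h1
    exact (RingTheory.Sequence.isWeaklyRegular_map_algebraMap_iff (Q ⧸ J) (Q ⧸ J) hs).2 h1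
  let _ : Module (Q ⧸ J) M := modOver J hJI M hM
  let _ : Module (Q ⧸ J) N := modOver J hJI N hN
  let _ : Module (Q ⧸ J) M' := modOver J hJI M' hM'
  let _ : Module (Q ⧸ J) N' := modOver J hJI N' hN'
  let _ : Module (Q ⧸ J) F := modOver J hJI F hF
  let _ : Module (Q ⧸ J) G := modOver J hJI G hG
  have _ : IsScalarTower Q (Q ⧸ J) M := (hM.mono' hJI).isScalarTower
  have _ : IsScalarTower Q (Q ⧸ J) N := (hN.mono' hJI).isScalarTower
  have _ : IsScalarTower Q (Q ⧸ J) M' := (hM'.mono' hJI).isScalarTower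
  have _ : IsScalarTower Q (Q ⧸ J) N' := (hN'.mono' hJI).isScalarTower
  have _ : IsScalarTower Q (Q ⧸ J) F := (hF.mono' hJI).isScalarTower
  have _ : IsScalarTower Q (Q ⧸ J) G := (hG.mono' hJI).isScalarTower
  refine main_aux M N M' N' F G (linOver J ιM) (linOver J πM) (linOver J ιN) (linOver J πN)
    hιM hπM hMexact hιN hπN hNexact ?_ ?_
  · obtain ⟨n, ⟨e⟩⟩ := hFfree
    obtain ⟨e'⟩ := quot_equiv I J hs hI2 F n e
    obtain ⟨m, hm⟩ := finite_pd _ hwr n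
    exact ⟨m, hasProjectiveDimensionLT_of_iso e'.toModuleIso.symm m⟩
  · obtain ⟨n, ⟨e⟩⟩ := hGfree
    obtain ⟨e'⟩ := quot_equiv I J hs hI2 G n e
    obtain ⟨m, hm⟩ := finite_id _ hwr n hid
    exact ⟨m, hasInjectiveDimensionLT_of_iso e'.toModuleIso.symm m⟩
end

section
/- Let M be a nonzero finitely generated maximal Cohen–Macaulay R-module, i.e., depth_R M = dim R. Then for every ideal J ⊆ I generated by a Q-regular sequence whose images in V are k-linearly independent: Ext^i_{Q/J}(M,k) ≠ 0 for infinitely many i if and only if Ext^i_{Q/J}(Hom_R(M,R),k) ≠ 0 for infinitely many i. (Equivalently, V_R^d(M) = V_R^d(Hom_R(M,R)).) -/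
open CategoryTheory IsLocalRing

theorem hom_isTorsionBySet (Q : Type) [CommRing Q] (I : Ideal Q)
    (M : Type) [AddCommGroup M] [Module Q M] :
    Module.IsTorsionBySet Q (M →ₗ[Q] Q ⧸ I) (I : Set Q) := fun φ a =>
  LinearMap.ext fun x => by
    simp only [LinearMap.smul_apply, LinearMap.zero_apply]
    exact @quot_isTorsionBySet Q _ I (φ x) a

section

section BasicExt
variable {Q : Type} [CommRing Q]

/-- `Ext^j_Q(N, P)` for unbundled modules. -/
abbrev EE (Q : Type) [CommRing Q] (N P : Type) [AddCommGroup N] [Module Q N]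
    [AddCommGroup P] [Module Q P] (j : ℕ) : Type :=
  Abelian.Ext (ModuleCat.of Q N) (ModuleCat.of Q P) j

variable {K F N P : Type} [AddCommGroup K] [Module Q K] [AddCommGroup F] [Module Q F]
  [AddCommGroup N] [Module Q N] [AddCommGroup P] [Module Q P]

/-- the short complex attached to an exact pair -/
abbrev sc (i : K →ₗ[Q] F) (p : F →ₗ[Q] N) (he : Function.Exact i p) :
    ShortComplex (ModuleCat.{0} Q) :=
  ShortComplex.mk (ModuleCat.ofHom i) (ModuleCat.ofHom p) (by
    ext x; simpa using he.apply_apply_eq_zero x)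

lemma sc_exact (i : K →ₗ[Q] F) (p : F →ₗ[Q] N) (he : Function.Exact i p)
    (hi : Function.Injective i) (hp : Function.Surjective p) : (sc i p he).ShortExact :=
  ModuleCat.shortComplex_shortExact _ he hi hp

lemma ext_sub₁ (i : K →ₗ[Q] F) (p : F →ₗ[Q] N) (he : Function.Exact i p)
    (hi : Function.Injective i) (hp : Function.Surjective p) (j : ℕ)
    (h2 : Subsingleton (EE Q F P j)) (h3 : Subsingleton (EE Q N P (j+1))) :
    Subsingleton (EE Q K P j) := by
  refine subsingleton_of_forall_eq 0 fun x => ?_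
  obtain ⟨y, hy⟩ := Abelian.Ext.contravariant_sequence_exact₁ (sc_exact i p he hi hp) _ x
    (add_comm 1 j) (@Subsingleton.elim _ h3 _ _)
  rw [← hy, @Subsingleton.elim _ h2 y 0, Abelian.Ext.comp_zero]

lemma ext_sub₂ (i : K →ₗ[Q] F) (p : F →ₗ[Q] N) (he : Function.Exact i p)
    (hi : Function.Injective i) (hp : Function.Surjective p) (j : ℕ)
    (h2 : Subsingleton (EE Q K P j)) (h3 : Subsingleton (EE Q N P j)) :
    Subsingleton (EE Q F P j) := by
  refine subsingleton_of_forall_eq 0 fun x => ?_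
  obtain ⟨y, hy⟩ := Abelian.Ext.contravariant_sequence_exact₂ (sc_exact i p he hi hp) _ x
     (@Subsingleton.elim _ h2 _ _)
  rw [← hy, @Subsingleton.elim _ h3 y 0, Abelian.Ext.comp_zero]

lemma ext_sub₃ (i : K →ₗ[Q] F) (p : F →ₗ[Q] N) (he : Function.Exact i p)
    (hi : Function.Injective i) (hp : Function.Surjective p) (j : ℕ)
    (h2 : Subsingleton (EE Q K P j)) (h3 : Subsingleton (EE Q F P (j+1))) :
    Subsingleton (EE Q N P (j+1)) := by
  refine subsingleton_of_forall_eq 0 fun x => ?_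
  obtain ⟨y, hy⟩ := Abelian.Ext.contravariant_sequence_exact₃ (sc_exact i p he hi hp) _ x
     (@Subsingleton.elim _ h3 _ _) (add_comm 1 j)
  rw [← hy, @Subsingleton.elim _ h2 y 0, Abelian.Ext.comp_zero]

/-- dimension shifting as a linear equivalence -/
lemma ext_shift (i : K →ₗ[Q] F) (p : F →ₗ[Q] N) (he : Function.Exact i p)
    (hi : Function.Injective i) (hp : Function.Surjective p) (j : ℕ)
    (h2 : Subsingleton (EE Q F P j)) (h3 : Subsingleton (EE Q F P (j+1))) :
    Nonempty (EE Q K P j ≃ₗ[Q] EE Q N P (j+1)) := by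
  refine ⟨LinearEquiv.ofBijective
    ((sc_exact i p he hi hp).extClass.precompOfLinear Q (ModuleCat.of Q P) (add_comm 1 j)) ⟨?_, ?_⟩⟩
  · rw [injective_iff_map_eq_zero]
    intro x hx
    obtain ⟨y, hy⟩ := Abelian.Ext.contravariant_sequence_exact₁ (sc_exact i p he hi hp) _ x
      (add_comm 1 j) hx
    rw [← hy, @Subsingleton.elim _ h2 y 0, Abelian.Ext.comp_zero]
  · intro x
    exact Abelian.Ext.contravariant_sequence_exact₃ (sc_exact i p he hi hp) _ x
     (@Subsingleton.elim _ h3 _ _) (add_comm 1 j)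

/-- Ext is invariant under linear equivalence in the first variable -/
lemma ext_congr (e : K ≃ₗ[Q] N) (j : ℕ) : Nonempty (EE Q N P j ≃ₗ[Q] EE Q K P j) := by
  refine ⟨LinearEquiv.ofLinearMap
    ((Abelian.Ext.mk₀ (ModuleCat.ofHom e.toLinearMap)).precompOfLinear Q _ (zero_add j))
    ((Abelian.Ext.mk₀ (ModuleCat.ofHom e.symm.toLinearMap)).precompOfLinear Q _ (zero_add j))
    ?_ ?_⟩
  · ext x
    simp [← ModuleCat.ofHom_comp]
  · ext x
    simp [← ModuleCat.ofHom_comp]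

lemma ext_sub_congr (e : K ≃ₗ[Q] N) (j : ℕ) (h : Subsingleton (EE Q K P j)) :
    Subsingleton (EE Q N P j) := by
  obtain ⟨f⟩ := ext_congr (P := P) e j
  exact f.toEquiv.subsingleton

lemma ext_sub_zero [Subsingleton N] (j : ℕ) : Subsingleton (EE Q N P j) := by
  have : (𝟙 (ModuleCat.of Q N)) = 0 := by ext x; exact Subsingleton.elim _ _
  refine subsingleton_of_forall_eq 0 fun x => ?_
  rw [← Abelian.Ext.mk₀_id_comp x, this, Abelian.Ext.mk₀_zero, Abelian.Ext.zero_comp]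

lemma smul_ext_eq_zero (x : Q) (hx : ∀ n : N, x • n = 0) (j : ℕ) (y : EE Q N P j) :
    x • y = 0 := by
  have : x • 𝟙 (ModuleCat.of Q N) = 0 := by ext n; exact hx n
  rw [← Abelian.Ext.mk₀_id_comp y, ← Abelian.Ext.smul_comp, ← Abelian.Ext.mk₀_smul, this,
    Abelian.Ext.mk₀_zero, Abelian.Ext.zero_comp]

end BasicExt

end

section
open scoped Pointwise

section Rees
variable {Q : Type} [CommRing Q]

/-- multiplication by a regular element as a short complex -/
abbrev msc (P : Type) [AddCommGroup P] [Module Q P] (x : Q) : ShortComplex (ModuleCat.{0} Q) :=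
  sc (LinearMap.lsmul Q P x) (x • (⊤ : Submodule Q P)).mkQ (LinearMap.exact_lsmul_mkQ_smul_top P x)

lemma msc_exact {P : Type} [AddCommGroup P] [Module Q P] (x : Q) (hx : IsSMulRegular P x) :
    (msc P x).ShortExact :=
  sc_exact _ _ _ hx (Submodule.mkQ_surjective _)

lemma msc_f {P : Type} [AddCommGroup P] [Module Q P] (x : Q) :
    ModuleCat.ofHom (LinearMap.lsmul Q P x) = x • 𝟙 (ModuleCat.of Q P) := rfl

lemma msc_comp_f {N P : Type} [AddCommGroup N] [Module Q N] [AddCommGroup P] [Module Q P]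
    (x : Q) (hN : ∀ n : N, x • n = 0) (j : ℕ) (y : EE Q N P j) :
    y.comp (Abelian.Ext.mk₀ (msc P x).f) (add_zero j) = 0 := by
  change y.comp (Abelian.Ext.mk₀ (x • 𝟙 (ModuleCat.of Q P))) (add_zero j) = 0
  rw [Abelian.Ext.mk₀_smul, Abelian.Ext.comp_smul]
  exact smul_ext_eq_zero x hN _ _

lemma rees_step_van {N P : Type} [AddCommGroup N] [Module Q N] [AddCommGroup P] [Module Q P]
    (x : Q) (hx : IsSMulRegular P x) (hN : ∀ n : N, x • n = 0) (l : ℕ)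
    (h : ∀ j < l, Subsingleton (EE Q N (QuotSMulTop x P) j)) :
    ∀ j < l + 1, Subsingleton (EE Q N P j) := by
  intro j hj
  refine subsingleton_of_forall_eq 0 fun y => ?_
  cases j with
  | zero =>
    obtain ⟨φ, rfl⟩ := (Abelian.Ext.mk₀_bijective _ _).2 y
    have : φ = 0 := by
      ext n
      apply hx
      change x • φ.hom n = x • (0 : P)
      rw [← map_smul, hN, map_zero, smul_zero]
    rw [this, Abelian.Ext.mk₀_zero]
  | succ j =>
    obtain ⟨z, hz⟩ := Abelian.Ext.covariant_sequence_exact₁ (ModuleCat.of Q N) (msc_exact x hx) y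
      (msc_comp_f x hN _ _) rfl
    rw [← hz, @Subsingleton.elim _ (h j (by omega)) z 0, Abelian.Ext.zero_comp]

lemma bij_comp_iso {X Y Z : ModuleCat.{0} Q} (e : Y ≅ Z) :
    Function.Bijective (fun φ : X ⟶ Y => φ ≫ e.hom) := by
  constructor
  · intro a b hab
    exact (cancel_mono e.hom).1 hab
  · intro a
    exact ⟨a ≫ e.inv, by simp⟩

lemma rees (rs : List Q) : ∀ (P : Type) [AddCommGroup P] [Module Q P],
    RingTheory.Sequence.IsWeaklyRegular P rs →
    (∀ (N : Type) [AddCommGroup N] [Module Q N], (∀ x ∈ rs, ∀ n : N, x • n = 0) →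
      ∀ j < rs.length, Subsingleton (EE Q N P j)) ∧
    ∃ ε : EE Q (P ⧸ Ideal.ofList rs • (⊤ : Submodule Q P)) P rs.length,
      ∀ (N : Type) [AddCommGroup N] [Module Q N], (∀ x ∈ rs, ∀ n : N, x • n = 0) →
      Function.Bijective (fun φ : ModuleCat.of Q N ⟶
        ModuleCat.of Q (P ⧸ Ideal.ofList rs • (⊤ : Submodule Q P)) =>
        (Abelian.Ext.mk₀ φ).comp ε (zero_add _)) := by
  induction rs with
  | nil =>
    intro P _ _ _
    refine ⟨by simp, ?_⟩
    have hb : Ideal.ofList ([] : List Q) • (⊤ : Submodule Q P) = ⊥ := by simp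
    let e := (Submodule.quotEquivOfEqBot _ hb)
    refine ⟨Abelian.Ext.mk₀ (e.toModuleIso.hom), fun N _ _ _ => ?_⟩
    have : (fun φ : ModuleCat.of Q N ⟶
        ModuleCat.of Q (P ⧸ Ideal.ofList ([] : List Q) • (⊤ : Submodule Q P)) =>
        (Abelian.Ext.mk₀ φ).comp (Abelian.Ext.mk₀ (e.toModuleIso.hom)) (zero_add _)) =
        (fun ψ => Abelian.Ext.mk₀ ψ) ∘ (fun φ => φ ≫ e.toModuleIso.hom) := by
      ext φ
      exact Abelian.Ext.mk₀_comp_mk₀ _ _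
    erw [this]
    exact (Abelian.Ext.mk₀_bijective _ _).comp (bij_comp_iso e.toModuleIso)
  | cons x rs ih =>
    intro P _ _ hreg
    rw [RingTheory.Sequence.isWeaklyRegular_cons_iff] at hreg
    obtain ⟨h1, ε, h2⟩ := ih (QuotSMulTop x P) hreg.2
    have hv : ∀ (N : Type) [AddCommGroup N] [Module Q N], (∀ x' ∈ x :: rs, ∀ n : N, x' • n = 0) →
      ∀ j < (x :: rs).length, Subsingleton (EE Q N P j) := by
      intro N _ _ hN
      exact rees_step_van x hreg.1 (hN x (by simp)) _
        (h1 N (fun y hy => hN y (by simp [hy])))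
    refine ⟨hv, ?_⟩
    have hS := msc_exact x hreg.1
    let e := Submodule.quotOfListConsSMulTopEquivQuotSMulTopInner P x rs
    let η : Abelian.Ext (ModuleCat.of Q (QuotSMulTop x P)) (ModuleCat.of Q P) 1 := hS.extClass
    refine ⟨(Abelian.Ext.mk₀ e.toModuleIso.hom).comp (ε.comp η rfl) (zero_add _),
      fun N _ _ hN => ?_⟩
    have key : Function.Bijective (fun y : Abelian.Ext (ModuleCat.of Q N)
        (ModuleCat.of Q (QuotSMulTop x P)) rs.length =>
        (y.comp η rfl : Abelian.Ext (ModuleCat.of Q N) (ModuleCat.of Q P) (rs.length + 1))) := by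
      constructor
      · let f := η.postcomp (ModuleCat.of Q N) (rfl : rs.length + 1 = rs.length + 1)
        change Function.Injective f
        rw [injective_iff_map_eq_zero]
        intro y hy
        obtain ⟨z, hz⟩ := Abelian.Ext.covariant_sequence_exact₃ (ModuleCat.of Q N) hS y rfl hy
        rw [← hz, @Subsingleton.elim _ (hv N hN rs.length (by simp)) z 0, Abelian.Ext.zero_comp]
      · intro y
        exact Abelian.Ext.covariant_sequence_exact₁ (ModuleCat.of Q N) hS y
          (msc_comp_f x (hN x (by simp)) _ _) rfl
    have h3 := key.comp (h2 N (fun y hy => hN y (by simp [hy])))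
    have h4 := h3.comp (bij_comp_iso (X := ModuleCat.of Q N) e.toModuleIso)
    have h5 : ∀ φ : ModuleCat.of Q N ⟶
        ModuleCat.of Q (P ⧸ Ideal.ofList (x :: rs) • (⊤ : Submodule Q P)),
        ((Abelian.Ext.mk₀ φ).comp ((Abelian.Ext.mk₀ e.toModuleIso.hom).comp (ε.comp η rfl)
          (zero_add (rs.length + 1))) (zero_add (rs.length + 1)) :
          Abelian.Ext (ModuleCat.of Q N) (ModuleCat.of Q P) (rs.length + 1)) =
        ((Abelian.Ext.mk₀ (φ ≫ e.toModuleIso.hom)).comp ε (zero_add rs.length)).comp η rfl := by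
      intro φ
      rw [← Abelian.Ext.mk₀_comp_mk₀_assoc]
      rw [Abelian.Ext.comp_assoc (Abelian.Ext.mk₀ φ) _ η (zero_add rs.length) rfl
        (by omega : 0 + rs.length + 1 = rs.length + 1)]
      rw [Abelian.Ext.comp_assoc _ ε η (zero_add rs.length) rfl
        (by omega : 0 + rs.length + 1 = rs.length + 1)]
    have h6 := funext h5
    change Function.Bijective (fun φ : ModuleCat.of Q N ⟶
        ModuleCat.of Q (P ⧸ Ideal.ofList (x :: rs) • (⊤ : Submodule Q P)) =>
        ((Abelian.Ext.mk₀ φ).comp ((Abelian.Ext.mk₀ e.toModuleIso.hom).comp (ε.comp η rfl)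
          (zero_add (rs.length + 1))) (zero_add (rs.length + 1)) :
          Abelian.Ext (ModuleCat.of Q N) (ModuleCat.of Q P) (rs.length + 1)))
    rw [h6]
    exact h4

end Rees

end

section
open scoped Pointwise

section GSsec
variable {Q : Type} [CommRing Q]

lemma ext_quot_van (Z : Type) [AddCommGroup Z] [Module Q Z] (rs : List Q) :
    ∀ (P : Type) [AddCommGroup P] [Module Q P] (a : ℕ),
    RingTheory.Sequence.IsWeaklyRegular P rs →
    (∀ j, a < j → Subsingleton (EE Q P Z j)) →
    ∀ j, a + rs.length < j →
      Subsingleton (EE Q (P ⧸ Ideal.ofList rs • (⊤ : Submodule Q P)) Z j) := by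
  induction rs with
  | nil =>
    intro P _ _ a _ h j hj
    have hb : Ideal.ofList ([] : List Q) • (⊤ : Submodule Q P) = ⊥ := by simp
    exact ext_sub_congr (Submodule.quotEquivOfEqBot _ hb).symm j (h j (by simpa using hj))
  | cons x rs ih =>
    intro P _ _ a hreg h j hj
    rw [RingTheory.Sequence.isWeaklyRegular_cons_iff] at hreg
    refine ext_sub_congr (Submodule.quotOfListConsSMulTopEquivQuotSMulTopInner P x rs).symm j ?_
    refine ih _ (a+1) hreg.2 ?_ j (by simp at hj; omega)
    intro j hj
    obtain ⟨j, rfl⟩ : ∃ i, j = i + 1 := ⟨j-1, by omega⟩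
    exact ext_sub₃ (LinearMap.lsmul Q P x) (x • (⊤ : Submodule Q P)).mkQ
      (LinearMap.exact_lsmul_mkQ_smul_top P x) hreg.1 (Submodule.mkQ_surjective _) j
      (h j (by omega)) (h _ (by omega))

/-- `N` is killed by `J` -/
def Tor (J : Ideal Q) (N : Type) [AddCommGroup N] [Module Q N] : Prop :=
  ∀ x ∈ J, ∀ n : N, x • n = 0

/-- The properties of an ideal generated by a regular sequence of length `d` which we use. -/
structure GS (J : Ideal Q) (d : ℕ) : Prop where
  van : ∀ (N : Type) [AddCommGroup N] [Module Q N], Tor J N →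
    ∀ j < d, Subsingleton (EE Q N Q j)
  eps : ∃ ε : EE Q (Q ⧸ J) Q d, ∀ (N : Type) [AddCommGroup N] [Module Q N], Tor J N →
    Function.Bijective (fun φ : ModuleCat.of Q N ⟶ ModuleCat.of Q (Q ⧸ J) =>
      (Abelian.Ext.mk₀ φ).comp ε (zero_add d))
  fin : ∀ j, d < j → ∀ r : ℕ, Subsingleton (EE Q (Fin r → Q ⧸ J) Q j)

lemma ext_pow_van {N Z : Type} [AddCommGroup N] [Module Q N] [AddCommGroup Z] [Module Q Z] (j : ℕ)
    (h : Subsingleton (EE Q N Z j)) (r : ℕ) : Subsingleton (EE Q (Fin r → N) Z j) := by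
  induction r with
  | zero => exact ext_sub_zero j
  | succ r ih =>
    refine ext_sub_congr (Fin.consLinearEquiv Q (fun _ => N)) j ?_
    refine ext_sub₂ (LinearMap.inl Q N (Fin r → N)) (LinearMap.snd Q N (Fin r → N))
      Function.Exact.inl_snd LinearMap.inl_injective LinearMap.snd_surjective j h ih

lemma GS_of_eq (J : Ideal Q) (rs : List Q) (hreg : RingTheory.Sequence.IsRegular Q rs)
    (hJ : J = Ideal.ofList rs) : GS J rs.length := by
  subst hJ
  have hT : ∀ (N : Type) [AddCommGroup N] [Module Q N], Tor (Ideal.ofList rs) N →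
      ∀ x ∈ rs, ∀ n : N, x • n = 0 := fun N _ _ h x hx n => h x (Ideal.subset_span hx) n
  have hs : Ideal.ofList rs = Ideal.ofList rs • (⊤ : Submodule Q Q) := by simp
  let e : (Q ⧸ Ideal.ofList rs • (⊤ : Submodule Q Q)) ≃ₗ[Q] (Q ⧸ Ideal.ofList rs) :=
    Submodule.quotEquivOfEq _ _ hs.symm
  obtain ⟨h1, ε, h2⟩ := rees rs Q hreg.toIsWeaklyRegular
  refine ⟨fun N _ _ h => h1 N (hT N h), ?_, ?_⟩
  · refine ⟨(Abelian.Ext.mk₀ e.toModuleIso.inv).comp ε (zero_add _), fun N _ _ h => ?_⟩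
    have h4 := (h2 N (hT N h)).comp (bij_comp_iso (X := ModuleCat.of Q N) e.toModuleIso.symm)
    have h5 : (fun φ : ModuleCat.of Q N ⟶ ModuleCat.of Q (Q ⧸ Ideal.ofList rs) =>
      (Abelian.Ext.mk₀ φ).comp ((Abelian.Ext.mk₀ e.toModuleIso.inv).comp ε (zero_add _))
        (zero_add rs.length)) = (fun φ => (Abelian.Ext.mk₀ φ).comp ε (zero_add _)) ∘
        (fun φ => φ ≫ e.toModuleIso.inv) := by
      funext φ
      simp only [Function.comp]
      rw [← Abelian.Ext.mk₀_comp_mk₀_assoc]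
    rw [h5]
    exact h4
  · intro j hj r
    apply ext_pow_van
    refine ext_sub_congr e j ?_
    refine ext_quot_van Q rs Q 0 hreg.toIsWeaklyRegular ?_ j (by simpa using hj)
    intro j hj
    obtain ⟨j, rfl⟩ : ∃ i, j = i + 1 := ⟨j-1, by omega⟩
    exact Abelian.Ext.subsingleton_of_projective _ _ _

end GSsec

end

section
open scoped Pointwise

section S5
variable {Q : Type} [CommRing Q] {J : Ideal Q} {d : ℕ}
variable {K F N : Type} [AddCommGroup K] [Module Q K] [AddCommGroup F] [Module Q F]
  [AddCommGroup N] [Module Q N]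

lemma GS.hom_equiv (hG : GS J d) (hN : Tor J N) :
    Nonempty ((N →ₗ[Q] Q ⧸ J) ≃ₗ[Q] EE Q N Q d) := by
  obtain ⟨ε, h⟩ := hG.eps
  let f : (ModuleCat.of Q N ⟶ ModuleCat.of Q (Q ⧸ J)) →ₗ[Q] EE Q N Q d :=
    (ε.postcompOfLinear Q (ModuleCat.of Q N) (zero_add d)) ∘ₗ
      (Abelian.Ext.linearEquiv₀ (R := Q)
        (X := ModuleCat.of Q N) (Y := ModuleCat.of Q (Q ⧸ J))).symm.toLinearMap
  exact ⟨(ModuleCat.homLinearEquiv (S := Q) (M := ModuleCat.of Q N)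
    (N := ModuleCat.of Q (Q ⧸ J))).symm ≪≫ₗ LinearEquiv.ofBijective f (h N hN)⟩

lemma GS.extend (hG : GS J d) (i : K →ₗ[Q] F) (p : F →ₗ[Q] N) (he : Function.Exact i p)
    (hi : Function.Injective i) (hp : Function.Surjective p) (hF : Tor J F)
    (hE : Subsingleton (EE Q N Q (d+1))) (φ : K →ₗ[Q] Q ⧸ J) :
    ∃ ψ : F →ₗ[Q] Q ⧸ J, ψ ∘ₗ i = φ := by
  obtain ⟨ε, h⟩ := hG.eps
  have hK : Tor J K := fun x hx n => hi (by rw [map_smul, hF x hx, map_zero])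
  obtain ⟨y, hy⟩ := Abelian.Ext.contravariant_sequence_exact₁ (sc_exact i p he hi hp) _
    ((Abelian.Ext.mk₀ (ModuleCat.ofHom φ)).comp ε (zero_add d))
    (add_comm 1 d) (@Subsingleton.elim _ hE _ _)
  obtain ⟨ψ, rfl⟩ := (h F hF).2 y
  refine ⟨ψ.hom, ?_⟩
  have h1 : ModuleCat.ofHom i ≫ ψ = ModuleCat.ofHom φ := by
    apply (h K hK).1
    simp only
    rw [← hy, ← Abelian.Ext.mk₀_comp_mk₀_assoc]
  exact congrArg ModuleCat.Hom.hom h1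

end S5

end

section
open scoped Pointwise

section Gor
variable {Q : Type} [CommRing Q] [IsLocalRing Q] [IsNoetherianRing Q]

lemma nak_step {N : Type} [AddCommGroup N] [Module Q N] [Module.Finite Q N] (x : Q)
    (hx : x ∈ maximalIdeal Q) (hreg : IsSMulRegular N x) (j : ℕ)
    (h : Subsingleton (EE Q (QuotSMulTop x N) Q (j+1))) : Subsingleton (EE Q N Q j) := by
  have h1 : ∀ y : EE Q N Q j, ∃ z : EE Q N Q j, x • z = y := by
    intro y
    obtain ⟨z, hz⟩ := Abelian.Ext.contravariant_sequence_exact₁ (msc_exact x hreg) _ y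
      (add_comm 1 j) (@Subsingleton.elim _ h _ _)
    refine ⟨z, ?_⟩
    change (Abelian.Ext.mk₀ (x • 𝟙 (ModuleCat.of Q N))).comp z (zero_add j) = y at hz
    rwa [Abelian.Ext.mk₀_smul, Abelian.Ext.smul_comp, Abelian.Ext.mk₀_id_comp] at hz
  have h2 : (⊤ : Submodule Q (EE Q N Q j)) = ⊥ := by
    apply Submodule.eq_bot_of_le_smul_of_le_jacobson_bot (maximalIdeal Q) _ Module.Finite.fg_top
    · intro y _
      obtain ⟨z, rfl⟩ := h1 y
      exact Submodule.smul_mem_smul hx trivial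
    · exact maximalIdeal_le_jacobson _
  exact (Submodule.subsingleton_iff Q).1 (subsingleton_of_bot_eq_top h2.symm)

lemma gor (n : ℕ) (h : ∀ j, n < j → Subsingleton (EE Q (Q ⧸ maximalIdeal Q) Q j)) :
    ∀ (𝔞 : Ideal Q) (N : Type) [AddCommGroup N] [Module Q N] [Module.Finite Q N], Tor 𝔞 N →
      ∀ j, n < j → Subsingleton (EE Q N Q j) := by
  intro 𝔞
  induction 𝔞 using WellFoundedGT.induction with
  | ind 𝔞 ih =>
  intro N _ _ _ hT
  revert hT
  refine IsNoetherianRing.induction_on_isQuotientEquivQuotientPrime Q (M := N) inferInstance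
    (motive := fun N _ _ _ => Tor 𝔞 N → ∀ j, n < j → Subsingleton (EE Q N Q j)) ?_ ?_ ?_
  · intro N _ _ _ _ _ j _
    exact ext_sub_zero j
  · intro N _ _ _ p e hT j hj
    refine ext_sub_congr e.symm j ?_
    have hle : 𝔞 ≤ p.asIdeal := by
      intro x hx
      have := hT x hx (e.symm (Ideal.Quotient.mk p.asIdeal 1))
      rw [← map_smul, e.symm.map_eq_zero_iff] at this
      have h2 : x • (Ideal.Quotient.mk p.asIdeal 1) = Ideal.Quotient.mk p.asIdeal (x * 1) := rfl
      rw [h2, mul_one] at this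
      exact Ideal.Quotient.eq_zero_iff_mem.1 this
    have hpm : p.asIdeal ≤ maximalIdeal Q := le_maximalIdeal p.2.ne_top
    by_cases hp : p.asIdeal = maximalIdeal Q
    · rw [hp]; exact h j hj
    obtain ⟨x, hx, hxp⟩ := SetLike.exists_of_lt (lt_of_le_of_ne hpm hp)
    refine nak_step x hx ?_ j ?_
    · intro a b hab
      obtain ⟨a, rfl⟩ := Ideal.Quotient.mk_surjective a
      obtain ⟨b, rfl⟩ := Ideal.Quotient.mk_surjective b
      change Ideal.Quotient.mk _ (x * a) = Ideal.Quotient.mk _ (x * b) at hab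
      rw [Ideal.Quotient.eq, ← mul_sub] at hab
      exact Ideal.Quotient.eq.2 ((p.2.mem_or_mem hab).resolve_left hxp)
    · refine ih (p.asIdeal ⊔ Ideal.span {x}) ?_ _ ?_ _ (by omega)
      · refine lt_of_le_of_ne (hle.trans le_sup_left) ?_
        intro hE
        exact hxp (hle (hE ▸ (Ideal.mem_sup_right (Ideal.mem_span_singleton_self x))))
      · intro y hy m
        obtain ⟨q, rfl⟩ := Submodule.mkQ_surjective _ m
        obtain ⟨q, rfl⟩ := Ideal.Quotient.mk_surjective q
        obtain ⟨a, ha, b, hb, rfl⟩ := Submodule.mem_sup.1 hy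
        obtain ⟨b, rfl⟩ := Ideal.mem_span_singleton'.1 hb
        rw [← map_smul]
        refine (Submodule.Quotient.mk_eq_zero _).2 ?_
        rw [Submodule.mem_smul_pointwise_iff_exists]
        refine ⟨Ideal.Quotient.mk _ (b * q), trivial, ?_⟩
        change Ideal.Quotient.mk _ (x * (b * q)) = Ideal.Quotient.mk _ ((a + b * x) * q)
        rw [Ideal.Quotient.eq]
        have : x * (b * q) - (a + b * x) * q = -(a * q) := by ring
        rw [this]
        exact neg_mem (Ideal.mul_mem_right _ _ ha)
  · intro N₁ _ _ _ N₂ _ _ _ N₃ _ _ _ f g hf hg he h1 h3 hT j hj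
    refine ext_sub₂ f g he hf hg j (h1 ?_ j hj) (h3 ?_ j hj)
    · intro x hx m
      exact hf (by rw [map_smul, hT x hx, map_zero])
    · intro x hx m
      obtain ⟨m, rfl⟩ := hg m
      rw [← map_smul, hT x hx, map_zero]

lemma ext_depth_van (n : ℕ) (h : ∀ (N : Type) [AddCommGroup N] [Module Q N] [Module.Finite Q N],
      ∀ j, n < j → Subsingleton (EE Q N Q j)) (rs : List Q) (hm : ∀ r ∈ rs, r ∈ maximalIdeal Q) :
    ∀ (N : Type) [AddCommGroup N] [Module Q N] [Module.Finite Q N],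
      RingTheory.Sequence.IsWeaklyRegular N rs → ∀ j, n < j + rs.length →
      Subsingleton (EE Q N Q j) := by
  induction rs with
  | nil => intro N _ _ _ _ j hj; exact h N j (by simpa using hj)
  | cons x rs ih =>
    intro N _ _ _ hreg j hj
    rw [RingTheory.Sequence.isWeaklyRegular_cons_iff] at hreg
    refine nak_step x (hm x (by simp)) hreg.1 j ?_
    exact ih (fun r hr => hm r (by simp [hr])) _ hreg.2 _ (by simp at hj; omega)

end Gor

end

section
open scoped Pointwise

section Dim
variable {Q : Type} [CommRing Q] [IsLocalRing Q] [IsNoetherianRing Q]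

lemma ofList_ofFn {c : ℕ} (f : Fin c → Q) :
    Ideal.span (Set.range f) = Ideal.ofList (List.ofFn f) := by
  unfold Ideal.ofList
  congr 1
  ext x
  simp [List.mem_ofFn]

lemma GS_ofFn {c : ℕ} (f : Fin c → Q) (h : RingTheory.Sequence.IsRegular Q (List.ofFn f))
    (J : Ideal Q) (hJ : J = Ideal.span (Set.range f)) : GS J c := by
  have := GS_of_eq J (List.ofFn f) h (hJ.trans (ofList_ofFn f))
  rwa [List.length_ofFn] at this

lemma exists_depth_seq (M : Type) [AddCommGroup M] [Module Q M] :
    ∃ rs : List Q, rs.length = localDepth Q M ∧ (∀ r ∈ rs, r ∈ maximalIdeal Q) ∧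
      RingTheory.Sequence.IsWeaklyRegular M rs := by
  by_cases h : localDepth Q M = 0
  · exact ⟨[], by simp [h], by simp, RingTheory.Sequence.IsWeaklyRegular.nil _ _⟩
  · unfold localDepth at h ⊢
    set S := {n | ∃ rs : List Q, rs.length = n ∧ (∀ r ∈ rs, r ∈ maximalIdeal Q) ∧
      RingTheory.Sequence.IsRegular M rs} with hS
    obtain ⟨rs, h1, h2, h3⟩ := Nat.sSup_mem (s := S)
      (Set.nonempty_iff_ne_empty.2 fun he => h (by rw [he]; simp)) (by
        by_contra hb
        exact h (Nat.sSup_of_not_bddAbove hb))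
    exact ⟨rs, h1, h2, h3.toIsWeaklyRegular⟩

lemma setup_van (hQreg : IsRegularLocal Q)
    (c : ℕ) (f : Fin c → Q)
    (hfreg : RingTheory.Sequence.IsRegular Q (List.ofFn f))
    (I : Ideal Q) (hIf : I = Ideal.span (Set.range f))
    (M : Type) [AddCommGroup M] [Module Q M] [Module.Finite Q M]
    (hMCM : ((localDepth Q M : WithTop ℕ) : WithBot (WithTop ℕ)) = ringKrullDim (Q ⧸ I)) :
    (∃ n : ℕ, ∀ (N : Type) [AddCommGroup N] [Module Q N] [Module.Finite Q N],
      ∀ j, n < j → Subsingleton (EE Q N Q j)) ∧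
    ∀ j, c < j → Subsingleton (EE Q M Q j) := by
  obtain ⟨rs, hrs, hmax⟩ := hQreg
  have hmax' : maximalIdeal Q = Ideal.ofList rs := hmax.symm
  have hG := GS_of_eq (maximalIdeal Q) rs hrs hmax'
  have hvan : ∀ (N : Type) [AddCommGroup N] [Module Q N] [Module.Finite Q N],
      ∀ j, rs.length < j → Subsingleton (EE Q N Q j) := by
    intro N _ _ _
    refine gor rs.length (fun j hj => ?_) ⊥ N ?_
    · exact ext_sub_congr (LinearEquiv.funUnique (Fin 1) Q (Q ⧸ maximalIdeal Q)) j (hG.fin j hj 1)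
    · intro x hx n
      rw [Ideal.mem_bot.1 hx, zero_smul]
  refine ⟨⟨_, hvan⟩, ?_⟩
  have h1 := ringKrullDim_add_length_eq_ringKrullDim_of_isRegular rs hrs
  have h2 := ringKrullDim_add_length_eq_ringKrullDim_of_isRegular _ hfreg
  rw [← ofList_ofFn, ← hIf, ← hMCM, ← h1, ← hmax', List.length_ofFn] at h2
  have h0 : ringKrullDim (Q ⧸ maximalIdeal Q) = 0 := by
    let _ := Ideal.Quotient.field (maximalIdeal Q)
    exact ringKrullDim_eq_zero_of_field _
  rw [h0] at h2
  have h3 : localDepth Q M + c = rs.length := by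
    rw [zero_add] at h2
    have h4 : ((localDepth Q M + c : ℕ) : WithBot ℕ∞) = ((rs.length : ℕ) : WithBot ℕ∞) := by
      rw [← h2]; push_cast; rfl
    exact_mod_cast h4
  obtain ⟨ys, hy1, hy2, hy3⟩ := exists_depth_seq (Q := Q) M
  intro j hj
  exact ext_depth_van _ hvan ys hy2 M hy3 j (by omega)

end Dim

end

section
open scoped Pointwise

section Dual
variable {Q : Type} [CommRing Q]

lemma Tor.hom {J : Ideal Q} {F : Type} [AddCommGroup F] [Module Q F] :
    Tor J (F →ₗ[Q] Q ⧸ J) := fun x hx φ => @hom_isTorsionBySet Q _ J F _ _ φ ⟨x, hx⟩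

lemma Tor.free {J : Ideal Q} {r : ℕ} : Tor J (Fin r → Q ⧸ J) := fun x hx v => by
  ext i; exact @quot_isTorsionBySet Q _ J (v i) ⟨x, hx⟩

lemma Tor.inj {J : Ideal Q} {K F : Type} [AddCommGroup F] [Module Q F] [AddCommGroup K] [Module Q K]
    (hF : Tor J F) (i : K →ₗ[Q] F) (hi : Function.Injective i) : Tor J K :=
  fun x hx n => hi (by rw [map_smul, hF x hx, map_zero])

lemma Tor.surj {J : Ideal Q} {K F : Type} [AddCommGroup F] [Module Q F] [AddCommGroup K] [Module Q K]
    (hF : Tor J F) (p : F →ₗ[Q] K) (hp : Function.Surjective p) : Tor J K :=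
  fun x hx n => by
    obtain ⟨n, rfl⟩ := hp n
    rw [← map_smul, hF x hx, map_zero]

lemma exists_pres (J : Ideal Q) (M : Type) [AddCommGroup M] [Module Q M] [Module.Finite Q M]
    (hM : Tor J M) : ∃ (r : ℕ) (p : (Fin r → Q ⧸ J) →ₗ[Q] M), Function.Surjective p := by
  obtain ⟨r, f, hf⟩ := Module.Finite.exists_fin' Q M
  let l : M → ((Q ⧸ J) →ₗ[Q] M) := fun m =>
    Submodule.liftQ J (LinearMap.toSpanSingleton Q M m) (fun x hx => hM x hx m)
  refine ⟨r, ∑ i, (l (f (Pi.single i 1))) ∘ₗ LinearMap.proj i, fun m => ?_⟩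
  obtain ⟨w, rfl⟩ := hf m
  refine ⟨fun i => Ideal.Quotient.mk J (w i), ?_⟩
  rw [LinearMap.sum_apply]
  conv_rhs => rw [LinearMap.pi_apply_eq_sum_univ f w]
  refine Finset.sum_congr rfl fun i _ => ?_
  have hs : (fun j => if i = j then (1 : Q) else 0) = Pi.single i 1 := by
    ext j
    simp [Pi.single_apply, eq_comm]
  rw [hs]
  rfl

lemma free_dual_apply {J : Ideal Q} {r : ℕ} (φ : (Fin r → Q ⧸ J) →ₗ[Q] Q ⧸ J) (v : Fin r → Q ⧸ J) :
    φ v = ∑ i, v i * φ (Pi.single i 1) := by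
  choose w hw using fun i => Ideal.Quotient.mk_surjective (v i)
  have hv : v = ∑ i, w i • (Pi.single i 1 : Fin r → Q ⧸ J) := by
    ext j
    rw [Finset.sum_apply, Finset.sum_eq_single j]
    · simp only [Pi.smul_apply, Pi.single_eq_same]
      rw [← hw]; change _ = Ideal.Quotient.mk J (w j * 1); rw [mul_one]
    · intro b _ hb
      simp [Pi.single_apply, Ne.symm hb]
    · simp
  conv_lhs => rw [hv]
  rw [map_sum]
  refine Finset.sum_congr rfl fun i _ => ?_
  rw [map_smul, ← hw]
  rw [Algebra.smul_def]
  rfl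

/-- the dual of a free module is free -/
noncomputable def dualFree (J : Ideal Q) (r : ℕ) :
    ((Fin r → Q ⧸ J) →ₗ[Q] Q ⧸ J) ≃ₗ[Q] (Fin r → Q ⧸ J) where
  toFun φ := fun i => φ (Pi.single i 1)
  map_add' _ _ := rfl
  map_smul' _ _ := rfl
  invFun w := ∑ i, (LinearMap.mulRight Q (w i)) ∘ₗ LinearMap.proj i
  left_inv φ := by
    refine LinearMap.ext fun v => ?_
    rw [free_dual_apply φ v]
    simp [LinearMap.sum_apply]
  right_inv w := by
    ext j
    simp [LinearMap.sum_apply, Pi.single_apply]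

lemma free_ev_surj {J : Ideal Q} {r : ℕ} (Ψ : ((Fin r → Q ⧸ J) →ₗ[Q] Q ⧸ J) →ₗ[Q] Q ⧸ J) :
    ∃ v, ∀ φ, Ψ φ = φ v := by
  refine ⟨fun i => Ψ (LinearMap.proj i), fun φ => ?_⟩
  choose w hw using fun i => Ideal.Quotient.mk_surjective (φ (Pi.single i 1))
  have h1 : φ = ∑ i, w i • (LinearMap.proj i : (Fin r → Q ⧸ J) →ₗ[Q] Q ⧸ J) := by
    refine LinearMap.ext fun v => ?_
    rw [free_dual_apply, LinearMap.sum_apply]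
    refine Finset.sum_congr rfl fun i _ => ?_
    rw [LinearMap.smul_apply, ← hw, Algebra.smul_def, mul_comm]
    rfl
  conv_lhs => rw [h1]
  rw [map_sum, free_dual_apply]
  refine Finset.sum_congr rfl fun i _ => ?_
  rw [map_smul, ← hw, Algebra.smul_def, mul_comm]
  rfl

variable {J : Ideal Q} {d : ℕ}
variable {K F N : Type} [AddCommGroup K] [Module Q K] [AddCommGroup F] [Module Q F]
  [AddCommGroup N] [Module Q N]

lemma dual_exact (i : K →ₗ[Q] F) (p : F →ₗ[Q] N) (he : Function.Exact i p)
    (hp : Function.Surjective p) (Z : Type) [AddCommGroup Z] [Module Q Z] :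
    Function.Exact (LinearMap.lcomp Q Z p) (LinearMap.lcomp Q Z i) := by
  intro φ
  constructor
  · intro h
    have hk : ∀ x, p x = 0 → φ x = 0 := by
      intro x hx
      obtain ⟨y, rfl⟩ := (he x).1 hx
      exact LinearMap.congr_fun h y
    refine ⟨(LinearMap.ker p).liftQ φ hk ∘ₗ (p.quotKerEquivOfSurjective hp).symm.toLinearMap, ?_⟩
    ext x
    have : (p.quotKerEquivOfSurjective hp).symm (p x) = (LinearMap.ker p).mkQ x := by
      rw [LinearEquiv.symm_apply_eq]; rfl
    simp only [LinearMap.lcomp_apply, LinearMap.comp_apply, LinearEquiv.coe_coe, this]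
    rfl
  · rintro ⟨ψ, rfl⟩
    ext x
    simp [he.apply_apply_eq_zero x]

lemma dual_inj (p : F →ₗ[Q] N)
    (hp : Function.Surjective p) (Z : Type) [AddCommGroup Z] [Module Q Z] :
    Function.Injective (LinearMap.lcomp Q Z p) := by
  intro a b hab
  ext n
  obtain ⟨x, rfl⟩ := hp n
  exact LinearMap.congr_fun hab x

lemma GS.dual_surj (hG : GS J d) (i : K →ₗ[Q] F) (p : F →ₗ[Q] N) (he : Function.Exact i p)
    (hi : Function.Injective i) (hp : Function.Surjective p) (hF : Tor J F)
    (hE : Subsingleton (EE Q N Q (d+1))) : Function.Surjective (LinearMap.lcomp Q (Q ⧸ J) i) :=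
  fun φ => hG.extend i p he hi hp hF hE φ

/-- maximal Cohen-Macaulay modules -/
structure InX (I : Ideal Q) (c : ℕ) (M : Type) [AddCommGroup M] [Module Q M] : Prop where
  fin : Module.Finite Q M
  tor : Tor I M
  van : ∀ j, c < j → Subsingleton (EE Q M Q j)

lemma ker_exact {F N : Type} [AddCommGroup F] [Module Q F] [AddCommGroup N] [Module Q N]
    (p : F →ₗ[Q] N) : Function.Exact (LinearMap.ker p).subtype p := by
  intro x; simp

variable [IsNoetherianRing Q] {I : Ideal Q} {c : ℕ}

lemma InX.ker (hG : GS I c) {M : Type} [AddCommGroup M] [Module Q M] (hM : InX I c M)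
    {r : ℕ} (p : (Fin r → Q ⧸ I) →ₗ[Q] M) (hp : Function.Surjective p) :
    InX I c (LinearMap.ker p) where
  fin := inferInstance
  tor := Tor.free.inj (LinearMap.ker p).subtype (Submodule.subtype_injective _)
  van j hj := ext_sub₁ _ p (ker_exact p) (Submodule.subtype_injective _) hp j
    (hG.fin j hj r) (hM.van _ (by omega))

lemma dual_finite {M : Type} [AddCommGroup M] [Module Q M] [Module.Finite Q M] (hM : Tor I M) :
    Module.Finite Q (M →ₗ[Q] Q ⧸ I) := by
  obtain ⟨r, p, hp⟩ := exists_pres I M hM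
  have : IsNoetherian Q ((Fin r → Q ⧸ I) →ₗ[Q] Q ⧸ I) :=
    isNoetherian_of_linearEquiv (dualFree I r).symm
  exact Module.Finite.of_injective _ (dual_inj p hp (Q ⧸ I))

lemma InX.dual_van (hG : GS I c) (n : ℕ)
    (hgor : ∀ (N : Type) [AddCommGroup N] [Module Q N] [Module.Finite Q N],
      ∀ j, n < j → Subsingleton (EE Q N Q j)) (t : ℕ) :
    ∀ (M : Type) [AddCommGroup M] [Module Q M], InX I c M → ∀ j, c < j → n < j + t →
      Subsingleton (EE Q (M →ₗ[Q] Q ⧸ I) Q j) := by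
  induction t with
  | zero =>
    intro M _ _ hM j _ hj
    have := hM.fin
    have := dual_finite hM.tor
    exact hgor _ j hj
  | succ t ih =>
    intro M _ _ hM j hc hj
    have := hM.fin
    obtain ⟨r, p, hp⟩ := exists_pres I M hM.tor
    refine ext_sub₁ _ _ (dual_exact _ p (ker_exact p) hp (Q ⧸ I)) (dual_inj p hp _)
      (hG.dual_surj _ p (ker_exact p) (Submodule.subtype_injective _) hp Tor.free
        (hM.van _ (by omega))) j ?_ ?_
    · exact ext_sub_congr (dualFree I r).symm j (hG.fin j hc r)
    · exact ih _ (hM.ker hG p hp) _ (by omega) (by omega)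

lemma InX.dual (hG : GS I c) (n : ℕ)
    (hgor : ∀ (N : Type) [AddCommGroup N] [Module Q N] [Module.Finite Q N],
      ∀ j, n < j → Subsingleton (EE Q N Q j)) 
    {M : Type} [AddCommGroup M] [Module Q M] (hM : InX I c M) : InX I c (M →ₗ[Q] Q ⧸ I) where
  fin := by have := hM.fin; exact dual_finite hM.tor
  tor := Tor.hom
  van j hj := InX.dual_van hG n hgor (n+1) M hM j hj (by omega)

lemma InX.ev_surj (hG : GS I c) (n : ℕ)
    (hgor : ∀ (N : Type) [AddCommGroup N] [Module Q N] [Module.Finite Q N],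
      ∀ j, n < j → Subsingleton (EE Q N Q j)) 
    {M : Type} [AddCommGroup M] [Module Q M] (hM : InX I c M)
    (ψ : (M →ₗ[Q] Q ⧸ I) →ₗ[Q] Q ⧸ I) : ∃ m, ∀ φ, ψ φ = φ m := by
  have := hM.fin
  obtain ⟨r, p, hp⟩ := exists_pres I M hM.tor
  obtain ⟨Ψ, hΨ⟩ := hG.extend _ _ (dual_exact _ p (ker_exact p) hp (Q ⧸ I)) (dual_inj p hp _)
      (hG.dual_surj _ p (ker_exact p) (Submodule.subtype_injective _) hp Tor.free
        (hM.van _ (by omega))) Tor.hom (((hM.ker hG p hp).dual hG n hgor).van _ (by omega)) ψ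
  obtain ⟨v, hv⟩ := free_ev_surj Ψ
  refine ⟨p v, fun φ => ?_⟩
  rw [← hΨ]
  exact hv (LinearMap.lcomp Q (Q ⧸ I) p φ)

lemma InX.ev_inj (hG : GS I c) (n : ℕ)
    (hgor : ∀ (N : Type) [AddCommGroup N] [Module Q N] [Module.Finite Q N],
      ∀ j, n < j → Subsingleton (EE Q N Q j)) 
    {M : Type} [AddCommGroup M] [Module Q M] (hM : InX I c M)
    (m : M) (h : ∀ φ : M →ₗ[Q] Q ⧸ I, φ m = 0) : m = 0 := by
  have := hM.fin
  obtain ⟨r, p, hp⟩ := exists_pres I M hM.tor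
  obtain ⟨v, rfl⟩ := hp m
  have hs := hG.dual_surj _ p (ker_exact p) (Submodule.subtype_injective _) hp Tor.free
        (hM.van _ (by omega))
  have h1 := dual_exact _ _ (dual_exact _ p (ker_exact p) hp (Q ⧸ I)) hs (Q ⧸ I)
  obtain ⟨θ, hθ⟩ := (h1 (LinearMap.applyₗ v)).1 (by ext φ; exact h φ)
  obtain ⟨k, hk⟩ := (hM.ker hG p hp).ev_surj hG n hgor θ
  have h2 : v = k := by
    ext i
    have := LinearMap.congr_fun hθ (LinearMap.proj i)
    change θ (LinearMap.lcomp Q (Q ⧸ I) (LinearMap.ker p).subtype (LinearMap.proj i)) = v i at this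
    rw [← this, hk]
    rfl
  rw [h2]
  exact k.2

lemma InX.bidual (hG : GS I c) (n : ℕ)
    (hgor : ∀ (N : Type) [AddCommGroup N] [Module Q N] [Module.Finite Q N],
      ∀ j, n < j → Subsingleton (EE Q N Q j)) 
    {M : Type} [AddCommGroup M] [Module Q M] (hM : InX I c M) :
    Nonempty (M ≃ₗ[Q] ((M →ₗ[Q] Q ⧸ I) →ₗ[Q] Q ⧸ I)) := by
  refine ⟨LinearEquiv.ofBijective LinearMap.applyₗ ⟨?_, ?_⟩⟩
  · rw [injective_iff_map_eq_zero]
    intro m hm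
    exact hM.ev_inj hG n hgor m (fun φ => LinearMap.congr_fun hm φ)
  · intro ψ
    obtain ⟨m, hm⟩ := hM.ev_surj hG n hgor ψ
    exact ⟨m, by ext φ; exact (hm φ).symm⟩

end Dual

end

section
open scoped Pointwise

section PDsec
variable {Q : Type} [CommRing Q]

/-- finite free resolution over `Q/J` of length `< n`. -/
def PDC (J : Ideal Q) : ℕ → ModuleCat.{0} Q → Prop
  | 0, N => Subsingleton N
  | n + 1, N => ∃ (r : ℕ) (p : (Fin r → Q ⧸ J) →ₗ[Q] N), Function.Surjective p ∧
      PDC J n (ModuleCat.of Q (LinearMap.ker p))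

/-- finite free resolution over `Q/J` of length `< n`, unbundled. -/
def PD (J : Ideal Q) (n : ℕ) (N : Type) [AddCommGroup N] [Module Q N] : Prop :=
  PDC J n (ModuleCat.of Q N)

variable {J : Ideal Q} {d : ℕ}
variable {K F N N' : Type} [AddCommGroup K] [Module Q K] [AddCommGroup F] [Module Q F]
  [AddCommGroup N] [Module Q N] [AddCommGroup N'] [Module Q N']

lemma PD_zero : PD J 0 N ↔ Subsingleton N := Iff.rfl

lemma PD_succ (n : ℕ) : PD J (n+1) N ↔ ∃ (r : ℕ) (p : (Fin r → Q ⧸ J) →ₗ[Q] N),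
    Function.Surjective p ∧ PD J n (LinearMap.ker p) := Iff.rfl

lemma PD.iso (n : ℕ) (e : N ≃ₗ[Q] N') (h : PD J n N) : PD J n N' := by
  cases n with
  | zero =>
    have : Subsingleton N := h
    exact e.symm.toEquiv.subsingleton
  | succ n =>
    obtain ⟨r, p, hp, hK⟩ := h
    refine ⟨r, e.toLinearMap ∘ₗ p, e.surjective.comp hp, ?_⟩
    have : LinearMap.ker (e.toLinearMap ∘ₗ p) = LinearMap.ker p := by
      ext x; simp
    change PD J n (LinearMap.ker (e.toLinearMap ∘ₗ p))
    rw [this]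
    exact hK

lemma PD.of_exact (n r : ℕ) (i : K →ₗ[Q] F) (p : F →ₗ[Q] N) (he : Function.Exact i p)
    (hi : Function.Injective i) (hp : Function.Surjective p) (e : F ≃ₗ[Q] (Fin r → Q ⧸ J))
    (h : PD J n K) : PD J (n+1) N := by
  refine ⟨r, p ∘ₗ e.symm.toLinearMap, hp.comp e.symm.surjective, ?_⟩
  let g : K →ₗ[Q] LinearMap.ker (p ∘ₗ e.symm.toLinearMap) :=
    LinearMap.codRestrict _ (e.toLinearMap ∘ₗ i) (fun k => by
      simp [he.apply_apply_eq_zero k])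
  refine PD.iso n (LinearEquiv.ofBijective g ⟨?_, ?_⟩) h
  · intro a b hab
    exact hi (e.injective (congrArg Subtype.val hab))
  · rintro ⟨x, hx⟩
    obtain ⟨k, hk⟩ := (he (e.symm x)).1 hx
    refine ⟨k, Subtype.ext ?_⟩
    change e (i k) = x
    rw [hk, e.apply_symm_apply]

lemma PD.one_of_equiv {r : ℕ} (e : N ≃ₗ[Q] (Fin r → Q ⧸ J)) : PD J 1 N := by
  refine PD.of_exact (K := PUnit) 0 r 0 LinearMap.id ?_ (fun _ _ _ => rfl) (fun x => ⟨x, rfl⟩) e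
    (PD_zero.2 inferInstance)
  intro x
  simp [eq_comm]

lemma PD.one_equiv (h : PD J 1 N) : ∃ r : ℕ, Nonempty (N ≃ₗ[Q] (Fin r → Q ⧸ J)) := by
  obtain ⟨r, p, hp, hK⟩ := h
  have : Subsingleton (LinearMap.ker p) := hK
  refine ⟨r, ⟨(LinearEquiv.ofBijective p ⟨?_, hp⟩).symm⟩⟩
  rw [← LinearMap.ker_eq_bot]
  exact (Submodule.subsingleton_iff_eq_bot).1 this

lemma PD.step (n : ℕ) : ∀ (N : Type) [AddCommGroup N] [Module Q N], PD J n N → PD J (n+1) N := by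
  induction n with
  | zero =>
    intro N _ _ h
    have : Subsingleton N := h
    refine PD.one_of_equiv (r := 0) (LinearEquiv.ofSubsingleton _ _)
  | succ n ih =>
    rintro N _ _ ⟨r, p, hp, hK⟩
    exact ⟨r, p, hp, ih _ hK⟩

lemma PD.mono {n m : ℕ} (hnm : n ≤ m) (h : PD J n N) : PD J m N := by
  induction hnm with
  | refl => exact h
  | step _ ih => exact PD.step _ N ih

lemma free_of_split [IsLocalRing Q] [Nontrivial (Q ⧸ J)] {r : ℕ} (p : (Fin r → Q ⧸ J) →ₗ[Q] N)
    (σ : N →ₗ[Q] (Fin r → Q ⧸ J)) (hσ : ∀ x, p (σ x) = x) : PD J 1 N := by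
  have hN : Module.IsTorsionBySet Q N (J : Set Q) := fun n x =>
    Tor.free.inj σ (fun a b hab => by rw [← hσ a, hab, hσ]) x.1 x.2 n
  let _ := hN.module
  have : IsScalarTower Q (Q ⧸ J) N := hN.isScalarTower
  have hs : Function.Surjective (algebraMap Q (Q ⧸ J)) := Ideal.Quotient.mk_surjective
  let p' := LinearMap.extendScalarsOfSurjective hs p
  let σ' := LinearMap.extendScalarsOfSurjective hs σ
  have h1 : p' ∘ₗ σ' = LinearMap.id := LinearMap.ext hσ
  have : Module.Projective (Q ⧸ J) N := Module.Projective.of_split σ' p' h1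
  have : Module.Finite (Q ⧸ J) N := Module.Finite.of_surjective p' (fun x => ⟨σ x, hσ x⟩)
  have : IsLocalRing (Q ⧸ J) := IsLocalRing.of_surjective' _ Ideal.Quotient.mk_surjective
  have : Module.Free (Q ⧸ J) N := Module.free_of_flat_of_isLocalRing
  let b := Module.finBasis (Q ⧸ J) N
  exact PD.one_of_equiv (b.equivFun.restrictScalars Q)

lemma PD.shrink [IsLocalRing Q] [Nontrivial (Q ⧸ J)] (hG : GS J d) (m : ℕ) :
    ∀ (N : Type) [AddCommGroup N] [Module Q N], PD J (m+2) N →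
    Subsingleton (EE Q N Q (d+m+1)) → PD J (m+1) N := by
  induction m with
  | zero =>
    rintro N _ _ ⟨r, p, hp, hK⟩ hE
    obtain ⟨s, ⟨e⟩⟩ := PD.one_equiv hK
    choose ρ hρ using fun a : Fin s => hG.extend _ p (ker_exact p) (Submodule.subtype_injective _) hp
      Tor.free hE (LinearMap.proj a ∘ₗ e.toLinearMap)
    let τ : (Fin r → Q ⧸ J) →ₗ[Q] LinearMap.ker p := e.symm.toLinearMap ∘ₗ LinearMap.pi ρ
    have hτ : ∀ k : LinearMap.ker p, τ k = k := by
      intro k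
      change e.symm _ = k
      rw [LinearEquiv.symm_apply_eq]
      ext a
      exact LinearMap.congr_fun (hρ a) k
    have hk : ∀ x, p x = 0 →
        (LinearMap.id - (LinearMap.ker p).subtype ∘ₗ τ : _ →ₗ[Q] (Fin r → Q ⧸ J)) x = 0 := by
      intro x hx
      have := hτ ⟨x, hx⟩
      simp only at this
      simp [this]
    let σ : N →ₗ[Q] (Fin r → Q ⧸ J) := (LinearMap.ker p).liftQ _ hk ∘ₗ
      (p.quotKerEquivOfSurjective hp).symm.toLinearMap
    refine free_of_split p σ fun x => ?_
    obtain ⟨x, rfl⟩ := hp x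
    have : (p.quotKerEquivOfSurjective hp).symm (p x) = (LinearMap.ker p).mkQ x := by
      rw [LinearEquiv.symm_apply_eq]; rfl
    change p ((LinearMap.ker p).liftQ _ hk ((p.quotKerEquivOfSurjective hp).symm (p x))) = p x
    rw [this]
    change p (x - (τ x : Fin r → Q ⧸ J)) = p x
    rw [map_sub, LinearMap.mem_ker.1 (τ x).2, sub_zero]
  | succ m ih =>
    rintro N _ _ ⟨r, p, hp, hK⟩ hE
    refine ⟨r, p, hp, ih _ hK ?_⟩
    exact ext_sub₁ _ p (ker_exact p) (Submodule.subtype_injective _) hp _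
      (hG.fin _ (by omega) r) hE

lemma GS.connecting (hG : GS J d) (i : K →ₗ[Q] F) (p : F →ₗ[Q] N) (he : Function.Exact i p)
    (hi : Function.Injective i) (hp : Function.Surjective p) (hF : Tor J F)
    (hE : Subsingleton (EE Q F Q (d+1))) :
    ∃ δ : (K →ₗ[Q] Q ⧸ J) →ₗ[Q] EE Q N Q (d+1), Function.Surjective δ ∧
      Function.Exact (LinearMap.lcomp Q (Q ⧸ J) i) δ := by
  obtain ⟨ε, h⟩ := hG.eps
  have hK : Tor J K := hF.inj i hi
  let f : (ModuleCat.of Q K ⟶ ModuleCat.of Q (Q ⧸ J)) →ₗ[Q] EE Q K Q d :=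
    (ε.postcompOfLinear Q (ModuleCat.of Q K) (zero_add d)) ∘ₗ
      (Abelian.Ext.linearEquiv₀ (R := Q)
        (X := ModuleCat.of Q K) (Y := ModuleCat.of Q (Q ⧸ J))).symm.toLinearMap
  have hf : Function.Bijective f := h K hK
  let g := (ModuleCat.homLinearEquiv (S := Q) (M := ModuleCat.of Q K)
    (N := ModuleCat.of Q (Q ⧸ J))).symm
  let η := (sc_exact i p he hi hp).extClass.precompOfLinear Q (ModuleCat.of Q Q) (add_comm 1 d)
  refine ⟨η ∘ₗ f ∘ₗ g.toLinearMap, ?_, ?_⟩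
  · intro x
    obtain ⟨y, hy⟩ := Abelian.Ext.contravariant_sequence_exact₃ (sc_exact i p he hi hp) _ x
     (@Subsingleton.elim _ hE _ _) (add_comm 1 d)
    obtain ⟨φ, rfl⟩ := hf.2 y
    exact ⟨φ.hom, hy⟩
  · intro φ
    constructor
    · intro hφ
      obtain ⟨y, hy⟩ := Abelian.Ext.contravariant_sequence_exact₁ (sc_exact i p he hi hp) _
        ((Abelian.Ext.mk₀ (ModuleCat.ofHom φ)).comp ε (zero_add d)) (add_comm 1 d) hφ
      obtain ⟨ψ, rfl⟩ := (h F hF).2 y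
      refine ⟨ψ.hom, ?_⟩
      have h1 : ModuleCat.ofHom i ≫ ψ = ModuleCat.ofHom φ := by
        apply (h K hK).1
        simp only
        rw [← hy, ← Abelian.Ext.mk₀_comp_mk₀_assoc]
      exact congrArg ModuleCat.Hom.hom h1
    · rintro ⟨ψ, rfl⟩
      change (sc_exact i p he hi hp).extClass.comp ((Abelian.Ext.mk₀
        (ModuleCat.ofHom i ≫ ModuleCat.ofHom ψ)).comp ε (zero_add d)) (add_comm 1 d) = 0
      rw [← Abelian.Ext.mk₀_comp_mk₀_assoc]
      exact (sc_exact i p he hi hp).extClass_comp_assoc _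

lemma PD.dual_step (hG : GS J d) (m : ℕ) :
    ∀ (q : ℕ) (N : Type) [AddCommGroup N] [Module Q N], PD J (m+2) N →
    (∀ j, 0 < j → j < m + 1 → Subsingleton (EE Q N Q (d+j))) →
    PD J q (N →ₗ[Q] Q ⧸ J) → PD J (q+m+2) (EE Q N Q (d+m+1)) := by
  induction m with
  | zero =>
    rintro q N _ _ ⟨r, p, hp, hK⟩ _ hq
    obtain ⟨s, ⟨e⟩⟩ := PD.one_equiv hK
    obtain ⟨δ, hδ, hex⟩ := hG.connecting _ p (ker_exact p) (Submodule.subtype_injective _) hp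
      Tor.free (hG.fin _ (by omega) r)
    have e' : (LinearMap.ker p →ₗ[Q] Q ⧸ J) ≃ₗ[Q] (Fin s → Q ⧸ J) :=
      (LinearEquiv.congrLeft (Q ⧸ J) Q e) ≪≫ₗ dualFree J s
    refine PD.of_exact (K := LinearMap.ker δ) (q+1) s (LinearMap.ker δ).subtype δ (ker_exact δ)
      (Submodule.subtype_injective _) hδ e' ?_
    let i := (LinearMap.ker p).subtype
    let w : ((Fin r → Q ⧸ J) →ₗ[Q] Q ⧸ J) →ₗ[Q] LinearMap.ker δ :=
      LinearMap.codRestrict _ (LinearMap.lcomp Q (Q ⧸ J) i) (fun φ => hex.apply_apply_eq_zero φ)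
    refine PD.of_exact q r (LinearMap.lcomp Q (Q ⧸ J) p) w ?_ (dual_inj p hp _) ?_ (dualFree J r) hq
    · intro φ
      rw [← dual_exact i p (ker_exact p) hp (Q ⧸ J) φ]
      exact Subtype.ext_iff
    · rintro ⟨θ, hθ⟩
      obtain ⟨φ, hφ⟩ := (hex θ).1 hθ
      exact ⟨φ, Subtype.ext hφ⟩
  | succ m ih =>
    rintro q N _ _ ⟨r, p, hp, hK⟩ hv hq
    have hE := hv 1 (by omega) (by omega)
    have h1 : PD J (q+1) (LinearMap.ker p →ₗ[Q] Q ⧸ J) :=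
      PD.of_exact q r _ _ (dual_exact _ p (ker_exact p) hp (Q ⧸ J)) (dual_inj p hp _)
        (hG.dual_surj _ p (ker_exact p) (Submodule.subtype_injective _) hp Tor.free hE)
        (dualFree J r) hq
    have h2 := ih (q+1) (LinearMap.ker p) hK (fun j h0 hj =>
      ext_sub₁ _ p (ker_exact p) (Submodule.subtype_injective _) hp _
      (hG.fin _ (by omega) r) (hv (j+1) (by omega) (by omega))) h1
    obtain ⟨e⟩ := ext_shift (P := Q) _ p (ker_exact p) (Submodule.subtype_injective _) hp (d+m+1)
      (hG.fin _ (by omega) r) (hG.fin _ (by omega) r)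
    exact PD.mono (by omega) (PD.iso _ e h2)

lemma PD.shrink' [IsLocalRing Q] [Nontrivial (Q ⧸ J)] (hG : GS J d) (m : ℕ)
    (hE : ∀ j, d + m < j → Subsingleton (EE Q N Q j)) (t : ℕ) (h : PD J (m+1+t) N) :
    PD J (m+1) N := by
  induction t with
  | zero => exact h
  | succ t ih =>
    refine ih ?_
    have := PD.shrink hG (m+t) N (PD.mono (by omega) h) (hE _ (by omega))
    exact PD.mono (by omega) this

/-- The main step -/
lemma PD.dual [IsLocalRing Q] [IsNoetherianRing Q] [Nontrivial (Q ⧸ J)] (hG : GS J d) {I : Ideal Q}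
    {c : ℕ} (hGI : GS I c) (hJI : J ≤ I) (hN : InX I c N) (n : ℕ) (h : PD J n N) :
    ∃ n', PD J n' (N →ₗ[Q] Q ⧸ I) := by
  have hT : Tor J N := fun x hx => hN.tor x (hJI hx)
  obtain ⟨eI⟩ := hGI.hom_equiv hN.tor
  obtain ⟨eJ⟩ := hG.hom_equiv hT
  rcases lt_or_ge c d with hcd | hcd
  · refine ⟨0, PD.iso 0 eI.symm (PD_zero.2 (hG.van N hT c hcd))⟩
  obtain ⟨m, rfl⟩ := Nat.exists_eq_add_of_le hcd
  have h1 : PD J (m+1) N := PD.shrink' hG m hN.van n (PD.mono (by omega) h)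
  cases m with
  | zero =>
    obtain ⟨r, ⟨e⟩⟩ := PD.one_equiv h1
    exact ⟨1, PD.iso 1 (eJ ≪≫ₗ eI.symm)
      (PD.one_of_equiv ((LinearEquiv.congrLeft (Q ⧸ J) Q e) ≪≫ₗ dualFree J r))⟩
  | succ m =>
    have h2 : PD J 0 (N →ₗ[Q] Q ⧸ J) :=
      PD.iso 0 eJ.symm (PD_zero.2 (hGI.van N hN.tor d (by omega)))
    have h3 := PD.dual_step hG m 0 N h1 (fun j _ hj => hGI.van N hN.tor _ (by omega)) h2
    exact ⟨_, PD.iso _ eI.symm h3⟩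

end PDsec

end

section

lemma old_ext_iff (A : Type) [CommRing A] (X Y : ModuleCat.{0} A) (n : ℕ) :
    Subsingleton (((Ext A (ModuleCat A) (n+1)).obj (Opposite.op X)).obj Y) ↔
      Subsingleton (Abelian.Ext X Y (n+1)) := by
  let P := projectiveResolution X
  have h1 : Subsingleton (((Ext A (ModuleCat A) (n+1)).obj (Opposite.op X)).obj Y) ↔
      ∀ f : P.complex.X (n+1) ⟶ Y, P.complex.d (n+2) (n+1) ≫ f = 0 →
        ∃ g, P.complex.d (n+1) n ≫ g = f := by
    rw [← ModuleCat.isZero_iff_subsingleton]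
    rw [(P.isoExt (R := A) (n+1) Y).isZero_iff, ← HomologicalComplex.exactAt_iff_isZero_homology]
    rw [HomologicalComplex.exactAt_iff' _ n (n+1) (n+2) (by simp) (by simp)]
    rw [ShortComplex.moduleCat_exact_iff]
    rfl
  rw [h1]
  constructor
  · intro h
    refine subsingleton_of_forall_eq 0 fun α => ?_
    obtain ⟨f, hf, rfl⟩ := P.extMk_surjective α (n+2) rfl
    rw [P.extMk_eq_zero_iff f _ rfl hf n rfl]
    exact h f hf
  · intro h f hf
    exact (P.extMk_eq_zero_iff f (n+2) rfl hf n rfl).1 (Subsingleton.elim _ _)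

section Bridge

lemma min_pres (A : Type) [CommRing A] [IsLocalRing A] (N : Type) [AddCommGroup N] [Module A N]
    [Module.Finite A N] : ∃ (r : ℕ) (p : (Fin r → A) →ₗ[A] N), Function.Surjective p ∧
      ∀ v, p v = 0 → ∀ i, v i ∈ maximalIdeal A := by
  classical
  have hex : ∃ r : ℕ, ∃ p : (Fin r → A) →ₗ[A] N, Function.Surjective p :=
    Module.Finite.exists_fin' A N
  obtain ⟨p, hp⟩ := Nat.find_spec hex
  have hmin : ∀ m, m < Nat.find hex → ¬ ∃ p : (Fin m → A) →ₗ[A] N, Function.Surjective p :=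
    fun m hm => Nat.find_min hex hm
  refine ⟨Nat.find hex, p, hp, ?_⟩
  generalize Nat.find hex = r at p hp hmin
  intro v hv i
  by_contra hi
  have hu : IsUnit (v i) := by
    by_contra h
    exact hi ((mem_maximalIdeal _).2 h)
  cases r with
  | zero => exact i.elim0
  | succ s =>
    refine hmin s (by omega) ⟨p ∘ₗ Function.ExtendByZero.linearMap A i.succAbove, fun n => ?_⟩
    obtain ⟨x, rfl⟩ := hp n
    obtain ⟨u, hu⟩ := hu
    let y := x - (x i * (↑u⁻¹ : A)) • v
    have hy : y i = 0 := by
      simp [y, ← hu]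
    refine ⟨y ∘ i.succAbove, ?_⟩
    have h1 : Function.ExtendByZero.linearMap A i.succAbove (y ∘ i.succAbove) = y := by
      ext j
      rw [Function.ExtendByZero.linearMap_apply]
      rcases Fin.eq_self_or_eq_succAbove i j with rfl | ⟨k, rfl⟩
      · rw [Function.extend_apply', hy]
        · rfl
        · rintro ⟨a, ha⟩
          exact Fin.succAbove_ne _ _ ha
      · rw [(Fin.succAbove_right_injective).extend_apply]; rfl
    rw [LinearMap.comp_apply, h1]
    simp [y, hv]

lemma free_to_k {A : Type} [CommRing A] [IsLocalRing A] {k : Type} [AddCommGroup k] [Module A k]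
    (hk : ∀ x ∈ maximalIdeal A, ∀ y : k, x • y = 0) {r : ℕ} (φ : (Fin r → A) →ₗ[A] k)
    (v : Fin r → A) (hv : ∀ i, v i ∈ maximalIdeal A) : φ v = 0 := by
  rw [LinearMap.pi_apply_eq_sum_univ φ v]
  exact Finset.sum_eq_zero fun i _ => hk _ (hv i) _

variable {Q : Type} [CommRing Q] {J : Ideal Q}

lemma PD.of_B {N : Type} [AddCommGroup N] [Module Q N] [Module (Q ⧸ J) N]
    [IsScalarTower Q (Q ⧸ J) N] {r : ℕ} (p : (Fin r → Q ⧸ J) →ₗ[Q ⧸ J] N)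
    (hp : Function.Surjective p) (n : ℕ) (h : PD J n (LinearMap.ker p)) : PD J (n+1) N := by
  refine PD.of_exact n r ((LinearMap.ker p).subtype.restrictScalars Q) (p.restrictScalars Q) ?_ 
    (Submodule.subtype_injective _) hp (LinearEquiv.refl _ _) h
  intro x
  simp

lemma PD.ext_van {k : Type} [AddCommGroup k] [Module (Q ⧸ J) k] (n : ℕ) :
    ∀ (N : Type) [AddCommGroup N] [Module Q N] [Module (Q ⧸ J) N]
    [IsScalarTower Q (Q ⧸ J) N], PD J n N → ∀ i, n ≤ i → Subsingleton (EE (Q ⧸ J) N k i) := by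
  induction n with
  | zero =>
    intro N _ _ _ _ h i _
    have : Subsingleton N := h
    exact ext_sub_zero i
  | succ n ih =>
    rintro N _ _ _ _ ⟨r, p, hp, hK⟩ i hi
    obtain ⟨i, rfl⟩ : ∃ j, i = j + 1 := ⟨i-1, by omega⟩
    have hs : Function.Surjective (algebraMap Q (Q ⧸ J)) := Ideal.Quotient.mk_surjective
    let p' : (Fin r → Q ⧸ J) →ₗ[Q ⧸ J] N := LinearMap.extendScalarsOfSurjective hs p
    let e : LinearMap.ker p ≃ₗ[Q] LinearMap.ker p' :=
      { toFun := fun x => ⟨x.1, x.2⟩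
        map_add' := fun _ _ => rfl
        map_smul' := fun _ _ => rfl
        invFun := fun x => ⟨x.1, x.2⟩
        left_inv := fun _ => rfl
        right_inv := fun _ => rfl }
    have h1 := ih (LinearMap.ker p') (PD.iso n e hK) i (by omega)
    refine ext_sub₃ _ p' (ker_exact p') (Submodule.subtype_injective _) hp i h1 ?_
    exact Abelian.Ext.subsingleton_of_projective _ _ _

lemma PD.of_ext_van [IsLocalRing (Q ⧸ J)] [IsNoetherianRing (Q ⧸ J)] {k : Type}
    [AddCommGroup k] [Module (Q ⧸ J) k] [Nontrivial k]
    (hk : ∀ x ∈ maximalIdeal (Q ⧸ J), ∀ y : k, x • y = 0) (n : ℕ) :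
    ∀ (N : Type) [AddCommGroup N] [Module Q N] [Module (Q ⧸ J) N]
    [IsScalarTower Q (Q ⧸ J) N] [Module.Finite (Q ⧸ J) N],
    Subsingleton (EE (Q ⧸ J) N k n) → PD J n N := by
  induction n with
  | zero =>
    intro N _ _ _ _ _ h
    obtain ⟨r, p, hp, hmin⟩ := min_pres (Q ⧸ J) N
    have h0 : ∀ φ : N →ₗ[Q ⧸ J] k, φ = 0 := by
      intro φ
      have := (Abelian.Ext.mk₀_bijective (ModuleCat.of (Q ⧸ J) N) (ModuleCat.of (Q ⧸ J) k)).1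
        (@Subsingleton.elim _ h (Abelian.Ext.mk₀ (ModuleCat.ofHom φ)) (Abelian.Ext.mk₀ 0))
      exact congrArg ModuleCat.Hom.hom this
    cases r with
    | zero => exact PD_zero.2 hp.subsingleton
    | succ s =>
      exfalso
      obtain ⟨y, hy⟩ := exists_ne (0 : k)
      let φ : (Fin (s+1) → Q ⧸ J) →ₗ[Q ⧸ J] k :=
        LinearMap.toSpanSingleton (Q ⧸ J) k y ∘ₗ LinearMap.proj 0
      obtain ⟨ψ, hψ⟩ := (dual_exact _ p (ker_exact p) hp k φ).1 (by
        ext v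
        exact free_to_k hk φ v (hmin v v.2))
      have : φ (Pi.single 0 1) = 0 := by
        rw [← hψ, h0 ψ]; rfl
      simp [φ] at this
      exact hy this
  | succ n ih =>
    intro N _ _ _ _ _ h
    obtain ⟨r, p, hp, hmin⟩ := min_pres (Q ⧸ J) N
    refine PD.of_B p hp n (ih _ ?_)
    cases n with
    | zero =>
      refine subsingleton_of_forall_eq 0 fun x => ?_
      obtain ⟨y, hy⟩ := Abelian.Ext.contravariant_sequence_exact₁
        (sc_exact _ p (ker_exact p) (Submodule.subtype_injective _) hp) _ x
        (add_comm 1 0) (@Subsingleton.elim _ h _ _)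
      obtain ⟨φ, rfl⟩ := (Abelian.Ext.mk₀_bijective _ _).2 y
      rw [← hy, Abelian.Ext.mk₀_comp_mk₀]
      have : ModuleCat.ofHom (LinearMap.ker p).subtype ≫ φ = 0 := by
        ext v
        exact free_to_k hk φ.hom v (hmin v v.2)
      change Abelian.Ext.mk₀ (ModuleCat.ofHom (LinearMap.ker p).subtype ≫ φ) = 0
      rw [this, Abelian.Ext.mk₀_zero]
    | succ n =>
      exact ext_sub₁ _ p (ker_exact p) (Submodule.subtype_injective _) hp _
        (Abelian.Ext.subsingleton_of_projective _ _ _) h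

end Bridge

end


lemma bridge {Q : Type} [CommRing Q] [IsLocalRing Q] [IsNoetherianRing Q] {I J : Ideal Q}
    (hJI : J ≤ I) (hJm : J ≤ maximalIdeal Q) (N : Type) [AddCommGroup N] [Module Q N]
    [Module.Finite Q N] (hN : Module.IsTorsionBySet Q N (I : Set Q)) :
    ¬ extInf (Q ⧸ J) N (Q ⧸ maximalIdeal Q) (modOver J hJI N hN) (kMod J hJm) ↔
      ∃ n, PD J n N := by
  have hJtop : J ≠ ⊤ := fun h => (maximalIdeal.isMaximal Q).ne_top (top_le_iff.1 (h ▸ hJm))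
  haveI : Nontrivial (Q ⧸ J) := Ideal.Quotient.nontrivial_iff.2 hJtop
  haveI : Nontrivial (Q ⧸ maximalIdeal Q) :=
    Ideal.Quotient.nontrivial_iff.2 (maximalIdeal.isMaximal Q).ne_top
  haveI : IsLocalRing (Q ⧸ J) :=
    IsLocalRing.of_surjective' (Ideal.Quotient.mk J) Ideal.Quotient.mk_surjective
  letI i1 : Module (Q ⧸ J) N := modOver J hJI N hN
  haveI : IsScalarTower Q (Q ⧸ J) N := (hN.mono' hJI).isScalarTower
  haveI : Module.Finite (Q ⧸ J) N := Module.Finite.of_restrictScalars_finite Q (Q ⧸ J) N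
  have key : ∀ i, Subsingleton (extMod (Q ⧸ J) N (Q ⧸ maximalIdeal Q) (modOver J hJI N hN)
      (kMod J hJm) (i+1)) ↔ Subsingleton (@EE (Q ⧸ J) _ N (Q ⧸ maximalIdeal Q) _ i1 _ (kMod J hJm) (i+1)) :=
    fun i => old_ext_iff (Q ⧸ J) _ _ i
  have hk : ∀ x ∈ maximalIdeal (Q ⧸ J), ∀ y : Q ⧸ maximalIdeal Q, (kMod J hJm).toSMul.smul x y = 0 := by
    intro x hx y
    obtain ⟨q, rfl⟩ := Ideal.Quotient.mk_surjective x
    have hq : q ∈ maximalIdeal Q := by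
      by_contra h
      exact hx ((by simpa using h : IsUnit q).map _)
    exact @quot_isTorsionBySet Q _ (maximalIdeal Q) y ⟨q, hq⟩
  constructor
  · intro h
    unfold extInf at h
    push Not at h
    obtain ⟨n, hn⟩ := h
    refine ⟨n+1, ?_⟩
    exact @PD.of_ext_van Q _ J _ _ _ _ (kMod J hJm) _ hk (n+1) N _ _ i1 _ _ ((key n).1 (hn (n+1) (by omega)))
  · rintro ⟨n, hn⟩ h
    obtain ⟨i, hi, hnt⟩ := h (n+1)
    obtain ⟨i, rfl⟩ : ∃ j, i = j + 1 := ⟨i-1, by omega⟩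
    have := (key i).2 (@PD.ext_van Q _ J _ _ (kMod J hJm) n N _ _ i1 _ hn (i+1) (by omega))
    exact not_nontrivial_iff_subsingleton.2 this hnt

/-- If `M` is maximal Cohen–Macaulay, then
`V_R^d(M) = V_R^d(Hom_R(M,R))`, pointwise. -/
theorem statement10
    (Q : Type) [CommRing Q] [IsLocalRing Q] [IsNoetherianRing Q]
    (hQreg : IsRegularLocal Q)
    (c : ℕ) (hc : 1 ≤ c) (f : Fin c → Q)
    (hfreg : RingTheory.Sequence.IsRegular Q (List.ofFn f))
    (I : Ideal Q) (hIf : I = Ideal.span (Set.range f))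
    (hIsq : I ≤ maximalIdeal Q ^ 2)
    (M : Type) [AddCommGroup M] [Module Q M] [Module.Finite Q M] [Nontrivial M]
    (hM : Module.IsTorsionBySet Q M (I : Set Q))
    (hMCM : ((localDepth Q M : WithTop ℕ) : WithBot (WithTop ℕ)) = ringKrullDim (Q ⧸ I))
    (d : ℕ) (g : Fin d → Q)
    (hgreg : RingTheory.Sequence.IsRegular Q (List.ofFn g))
    (hglin : LinIndepInV Q I g)
    (J : Ideal Q) (hJg : J = Ideal.span (Set.range g)) (hJI : J ≤ I)
 :
    extInf (Q ⧸ J) M (Q ⧸ maximalIdeal Q) (modOver J hJI M hM) (kMod J (hJI.trans (hIsq.trans (Ideal.pow_le_self two_ne_zero)))) ↔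
      extInf (Q ⧸ J) (M →ₗ[Q] Q ⧸ I) (Q ⧸ maximalIdeal Q)
        (modOver J hJI (M →ₗ[Q] Q ⧸ I) (hom_isTorsionBySet Q I M))
        (kMod J (hJI.trans (hIsq.trans (Ideal.pow_le_self two_ne_zero)))) := by
  have hJm : J ≤ maximalIdeal Q := hJI.trans (hIsq.trans (Ideal.pow_le_self two_ne_zero))
  have hJtop : J ≠ ⊤ := fun h => (maximalIdeal.isMaximal Q).ne_top (top_le_iff.1 (h ▸ hJm))
  haveI : Nontrivial (Q ⧸ J) := Ideal.Quotient.nontrivial_iff.2 hJtop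
  have hGI := GS_ofFn f hfreg I hIf
  have hG := GS_ofFn g hgreg J hJg
  obtain ⟨⟨n, hgor⟩, hvan⟩ := setup_van hQreg c f hfreg I hIf M hMCM
  have hX : InX I c M := ⟨inferInstance, fun x hx m => @hM m ⟨x, hx⟩, hvan⟩
  have hX' := hX.dual hGI n hgor
  haveI := hX'.fin
  obtain ⟨e⟩ := hX.bidual hGI n hgor
  rw [← not_iff_not, bridge hJI hJm, bridge hJI hJm]
  constructor
  · rintro ⟨m, hm⟩
    exact PD.dual hG hGI hJI hX m hm
  · rintro ⟨m, hm⟩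
    obtain ⟨m', h'⟩ := PD.dual hG hGI hJI hX' m hm
    exact ⟨m', PD.iso m' e.symm h'⟩
end
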